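/- arXiv:1003.2019 — 4 statements merged into one kernel-verified Lean document; each statement's English description precedes it below -/
import Mathlib

section
/- Let λ ∈ (−π/2, π/2), let q > 0, and assume 0 < cos λ < 1/(1 + 2q). Let f be analytic on the unit disk 𝔻 with f(0) = 0, f'(0) = 1, f''(0) = 0, f'(z) ≠ 0 on 𝔻 and f(z) ≠ 0 for z ≠ 0. If Re(e^{−iλ}(1 + z f''(z)/f'(z) + q · z f'(z)/f(z))) > 0 for all z ∈ 𝔻 (where z f'(z)/f(z) is interpreted as 1 at z = 0), then f is univalent (injective) on 𝔻. -/
open Metric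

open Filter Topology in
theorem aux_motion (b : ℝ → ℂ) (b' : ℂ) (τ : ℝ) (β : ℂ → ℂ) (β' ζ : ℂ)
    (hb : HasDerivAt b b' τ) (hβ : HasStrictDerivAt β β' ζ) (hβ0 : β' ≠ 0)
    (heq : β ζ = b τ) (hζ : ζ ≠ 0) (hre : (b' / (β' * ζ)).re < -1) :
    ∃ Z : ℝ → ℂ, Tendsto Z (𝓝[>] τ) (𝓝 ζ) ∧
      ∀ᶠ t in 𝓝[>] τ, β (Z t) = b t ∧ ‖Z t‖ ≤ ‖ζ‖ * Real.exp (τ - t) := by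
  set I := hβ.localInverse β β' ζ hβ0 with hI
  have hI1 : HasStrictDerivAt I β'⁻¹ (b τ) := heq ▸ hβ.to_localInverse hβ0
  have hI0 : I (b τ) = ζ := by
    rw [← heq]
    exact (hβ.hasStrictFDerivAt_equiv hβ0).localInverse_apply_image
  have hIr : ∀ᶠ y in 𝓝 (b τ), β (I y) = y := by
    rw [← heq]
    exact (hβ.hasStrictFDerivAt_equiv hβ0).eventually_right_inverse
  have hZ : HasDerivAt (fun t => I (b t)) (β'⁻¹ * b') τ := by
    have := hI1.hasDerivAt.scomp τ hb
    simpa [Function.comp_def, mul_comm] using this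
  refine ⟨fun t => I (b t), ?_, ?_⟩
  · have := hZ.continuousAt.tendsto
    simp only [hI0] at this
    exact this.mono_left nhdsWithin_le_nhds
  · have h1 : ∀ᶠ t in 𝓝[>] τ, β (I (b t)) = b t :=
      (hb.continuousAt.eventually hIr).filter_mono nhdsWithin_le_nhds
    have he : HasDerivAt (fun t : ℝ => (Real.exp t : ℂ)) (Real.exp τ : ℂ) τ :=
      (Real.hasDerivAt_exp τ).ofReal_comp
    have hN := (hZ.mul he).norm_sq
    have hneg : 2 * inner ℝ (I (b τ) * (Real.exp τ : ℂ))
        (β'⁻¹ * b' * (Real.exp τ : ℂ) + I (b τ) * (Real.exp τ : ℂ)) < 0 := by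
      rw [hI0]
      have : β'⁻¹ * b' * (Real.exp τ : ℂ) + ζ * (Real.exp τ : ℂ)
        = (b' / (β' * ζ) + 1) * (ζ * (Real.exp τ : ℂ)) := by
        field_simp
      rw [this]
      set v := ζ * (Real.exp τ : ℂ) with hv
      have hv0 : v ≠ 0 := by simp [hv, hζ]
      set u := b' / (β' * ζ) + 1 with hu
      have hu0 : u.re < 0 := by simp [hu]; linarith
      have : inner ℝ v (u * v) = u.re * ‖v‖^2 := by
        rw [Complex.inner, ← Complex.normSq_eq_norm_sq, Complex.normSq_apply]
        simp
        ring
      rw [this]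
      have : 0 < ‖v‖^2 := by positivity
      nlinarith
    have h2 := (hasDerivAt_iff_tendsto_slope.1 hN).eventually_lt_const hneg
    have h3 := h2.filter_mono (nhdsWithin_mono τ (fun x (hx : τ < x) => hx.ne'))
    filter_upwards [h1, h3, self_mem_nhdsWithin] with t a1 a2 a3
    refine ⟨a1, ?_⟩
    have a3' : (0:ℝ) < t - τ := sub_pos.2 a3
    rw [slope_def_field, div_lt_iff₀ a3', zero_mul, sub_neg] at a2
    have a4 := abs_lt_of_sq_lt_sq a2 (norm_nonneg _)
    simp only [Pi.mul_apply, norm_mul, hI0, Complex.norm_real, Real.norm_eq_abs, Real.abs_exp] at a4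
    rw [Real.exp_sub, ← mul_div_assoc, le_div_iff₀ (Real.exp_pos _)]
    exact (le_abs_self _).trans a4.le

theorem aux_inj (S : Set ℂ) (hS : Convex ℝ S) (g g' : ℂ → ℂ) (d : ℂ) (C : ℝ)
    (hg : ∀ x ∈ S, HasDerivAt g (g' x) x) (hC : ∀ x ∈ S, ‖g' x - d‖ ≤ C) (hd : C < ‖d‖) :
    Set.InjOn g S := by
  intro x hx y hy hxy
  have := hS.norm_image_sub_le_of_norm_hasDerivWithin_le (f := fun x => g x - d * x)
    (f' := fun x => g' x - d) (C := C)
    (fun x hx => by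
      have : HasDerivAt (fun x => g x - d * x) (g' x - d * 1) x :=
        (hg x hx).sub ((hasDerivAt_id x).const_mul d)
      simpa using this.hasDerivWithinAt) hC hx hy
  rw [hxy] at this
  have h2 : g y - d * y - (g y - d * x) = - (d * (y - x)) := by ring
  rw [h2, norm_neg, norm_mul] at this
  by_contra hne
  have : 0 < ‖y - x‖ := norm_pos_iff.2 (sub_ne_zero.2 (Ne.symm hne))
  nlinarith

open Filter Topology in
theorem aux_logderiv (L V : ℂ → ℂ) (V' z : ℂ) (hL : ContinuousAt L z)
    (hV : HasDerivAt V V' z) (h : ∀ᶠ x in 𝓝 z, Complex.exp (L x) = V x) :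
    HasDerivAt L (V' / V z) z := by
  have hz : Complex.exp (L z) = V z := h.self_of_nhds
  have hV0 : V z ≠ 0 := hz ▸ Complex.exp_ne_zero _
  have h1 : HasDerivAt (fun x => Complex.log (V x / V z)) (V' / V z) z := by
    have := (hV.div_const (V z)).clog (by rw [div_self hV0]; simp)
    simpa [hV0] using this
  have h2 : HasDerivAt (fun x => Complex.log (V x / V z) + L z) (V' / V z) z := h1.add_const _
  refine h2.congr_of_eventuallyEq ?_
  have h3 : ∀ᶠ x in 𝓝 z, ‖L x - L z‖ < 1 := by
    have : ContinuousAt (fun x => ‖L x - L z‖) z := by fun_prop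
    exact this.eventually_lt continuousAt_const (by simp)
  filter_upwards [h, h3] with x a1 a2
  rw [← a1, ← hz, ← Complex.exp_sub, Complex.log_exp]
  · ring
  · have := (abs_le.1 (Complex.abs_im_le_norm (L x - L z))).1
    linarith [Real.pi_gt_three]
  · have := (abs_le.1 (Complex.abs_im_le_norm (L x - L z))).2
    linarith [Real.pi_gt_three]

theorem aux_re (μ : ℂ) (h : ‖μ‖ < 1) : (-2 / (1 - μ)).re < -1 := by
  have h0 : (1 - μ) ≠ 0 := by
    intro h0
    have : μ = 1 := by linear_combination -h0
    simp [this] at h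
  have h1 : 0 < Complex.normSq (1 - μ) := Complex.normSq_pos.2 h0
  have h2 : Complex.normSq μ < 1 := by
    rw [Complex.normSq_eq_norm_sq]; nlinarith [norm_nonneg μ]
  rw [Complex.div_re, ← add_div, div_lt_iff₀ h1]
  rw [Complex.normSq_apply] at h1 h2 ⊢
  simp at h1 h2 ⊢
  nlinarith

theorem aux_bound (n y : ℝ) (hn : 1 ≤ n) (hy : 0 ≤ y) (w : ℂ) (hw : ‖w‖ ≤ Real.exp (-y))
    (hw1 : ‖w‖ < 1) :
    ‖-((n / 2 * Real.exp (-(n * y)) : ℝ) : ℂ) + ((1 - Real.exp (-(n * y)) : ℝ) : ℂ) * (w / (1 - w))‖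
      ≤ n / 2 := by
  rcases hy.eq_or_lt with rfl | hy
  · simp [abs_of_pos (by linarith : 0 < n)]
  set ρ := Real.exp (-y) with hρ
  set x := Real.exp (-(n * y)) with hx
  have hρ0 : 0 < ρ := Real.exp_pos _
  have hρ1 : ρ < 1 := by rw [hρ]; simpa using hy
  have hx0 : 0 < x := Real.exp_pos _
  have hny : 0 < n * y := by positivity
  have hx1 : x < 1 := by rw [hx]; simpa using hny
  have hw0 : 1 - w ≠ 0 := by
    intro h0
    have : w = 1 := by linear_combination -h0
    simp [this] at hw1
  have h1 : 0 < 1 - ρ^2 := by nlinarith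
  have e1 : ‖w / (1 - w) - ((ρ^2 / (1 - ρ^2) : ℝ) : ℂ)‖ ≤ ρ / (1 - ρ^2) := by
    have h1c : (1 - (ρ:ℂ)^2) ≠ 0 := by exact_mod_cast h1.ne'
    have : w / (1 - w) - ((ρ^2 / (1 - ρ^2) : ℝ) : ℂ)
      = (w - (ρ^2 : ℝ)) / ((1 - w) * ((1 - ρ^2 : ℝ) : ℂ)) := by
      push_cast
      field_simp
      ring
    rw [this, norm_div, norm_mul, Complex.norm_real, Real.norm_of_nonneg h1.le]
    have hw0' : 0 < ‖1 - w‖ := norm_pos_iff.2 hw0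
    rw [div_le_div_iff₀ (by positivity) h1]
    have : ‖w - (ρ^2 : ℝ)‖ ≤ ρ * ‖1 - w‖ := by
      apply le_of_sq_le_sq _ (by positivity)
      rw [mul_pow, ← Complex.normSq_eq_norm_sq, ← Complex.normSq_eq_norm_sq]
      have : Complex.normSq w ≤ ρ^2 := by
        rw [Complex.normSq_eq_norm_sq]; nlinarith [norm_nonneg w]
      rw [Complex.normSq_apply] at this ⊢
      rw [Complex.normSq_apply]
      simp only [Complex.sub_re, Complex.sub_im, Complex.ofReal_re, Complex.ofReal_im, Complex.one_re, Complex.one_im]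
      nlinarith
    nlinarith
  have e2 : 2 * ρ * (1 - x) ≤ n * (1 - ρ) * (1 + x) := by
    -- tanh bound
    have t1 : 2 * (1 - x) ≤ n * y * (1 + x) := by
      have key : ∀ t : ℝ, 0 ≤ t → 2 * (1 - Real.exp (-t)) ≤ t * (1 + Real.exp (-t)) := by
        intro t ht
        have mono : MonotoneOn (fun t : ℝ => t * (1 + Real.exp (-t)) - 2 * (1 - Real.exp (-t))) (Set.Ici 0) := by
          have hd : ∀ t : ℝ, HasDerivAt (fun t : ℝ => t * (1 + Real.exp (-t)) - 2 * (1 - Real.exp (-t)))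
            (1 - Real.exp (-t) - t * Real.exp (-t)) t := by
            intro t
            have h0 : HasDerivAt (fun t : ℝ => Real.exp (-t)) (- Real.exp (-t)) t := by
              simpa using (hasDerivAt_neg t).exp
            refine HasDerivAt.congr_deriv
              (((hasDerivAt_id t).mul (h0.const_add 1)).sub ((h0.const_sub 1).const_mul 2)) ?_
            simp only [id]
            ring
          apply monotoneOn_of_hasDerivWithinAt_nonneg (convex_Ici 0)
            (fun t _ => (hd t).continuousAt.continuousWithinAt)
            (fun t _ => (hd t).hasDerivWithinAt)
          intro t _
          have := Real.add_one_le_exp t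
          have h3 : Real.exp t * Real.exp (-t) = 1 := by rw [← Real.exp_add]; simp
          nlinarith [Real.exp_pos (-t)]
        have := mono (Set.mem_Ici.2 le_rfl) (Set.mem_Ici.2 ht) ht
        simp at this
        linarith
      exact key (n * y) hny.le
    have t2 : y * ρ ≤ 1 - ρ := by
      have := Real.add_one_le_exp y
      have h3 : Real.exp y * ρ = 1 := by rw [hρ, ← Real.exp_add]; simp
      nlinarith
    have t3 : ρ * (2 * (1 - x)) ≤ ρ * (n * y * (1 + x)) := by gcongr
    have t4 : n * (1 + x) * (y * ρ) ≤ n * (1 + x) * (1 - ρ) := by gcongr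
    linarith
  have e3 : ‖-((n / 2 * x : ℝ) : ℂ) + ((1 - x : ℝ) : ℂ) * (w / (1 - w))‖
     ≤ |-(n / 2 * x) + (1 - x) * (ρ^2 / (1 - ρ^2))| + (1 - x) * (ρ / (1 - ρ^2)) := by
    have : -((n / 2 * x : ℝ) : ℂ) + ((1 - x : ℝ) : ℂ) * (w / (1 - w))
      = ((-(n / 2 * x) + (1 - x) * (ρ^2 / (1 - ρ^2)) : ℝ) : ℂ) +
       ((1 - x : ℝ) : ℂ) * (w / (1 - w) - ((ρ^2 / (1 - ρ^2) : ℝ) : ℂ)) := by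
      push_cast; ring
    rw [this]
    refine (norm_add_le _ _).trans ?_
    rw [norm_mul, Complex.norm_real, Complex.norm_real, Real.norm_eq_abs, Real.norm_of_nonneg (by linarith : 0 ≤ 1 - x)]
    gcongr
  refine e3.trans ?_
  have f1 : (1 - x) * (ρ / (1 - ρ^2)) + (1 - x) * (ρ^2 / (1 - ρ^2)) = (1 - x) * ρ / (1 - ρ) := by
    have : 1 - ρ^2 = (1 - ρ) * (1 + ρ) := by ring
    rw [this]
    have : 1 - ρ ≠ 0 := by linarith
    field_simp
  have f2 : (1 - x) * (ρ / (1 - ρ^2)) - (1 - x) * (ρ^2 / (1 - ρ^2)) = (1 - x) * ρ / (1 + ρ) := by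
    have : 1 - ρ^2 = (1 - ρ) * (1 + ρ) := by ring
    rw [this]
    have : 1 - ρ ≠ 0 := by linarith
    field_simp
  have g1 : (1 - x) * ρ / (1 - ρ) ≤ n / 2 * (1 + x) := by
    rw [div_le_iff₀ (by linarith)]; nlinarith
  have g2 : (1 - x) * ρ / (1 + ρ) ≤ n / 2 * (1 - x) := by
    rw [div_le_iff₀ (by linarith)]
    have : (1 - x) * ρ ≤ (1 - x) * (n / 2 * (1 + ρ)) := by
      apply mul_le_mul_of_nonneg_left _ (by linarith)
      nlinarith
    linarith
  rcases abs_cases (-(n / 2 * x) + (1 - x) * (ρ^2 / (1 - ρ^2))) with ⟨h, _⟩ | ⟨h, _⟩ <;> rw [h] <;> linarith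

structure AuxDat (n : ℝ) (c : ℂ) (f f1 s s1 P : ℂ → ℂ) : Prop where
  hn : 1 ≤ n
  hc : ‖c‖ < 1
  hf : ∀ z ∈ ball (0 : ℂ) 1, HasDerivAt f (f1 z) z
  hs : ∀ z ∈ ball (0 : ℂ) 1, HasDerivAt s (s1 z) z
  cf1 : ContinuousOn f1 (ball (0 : ℂ) 1)
  cs1 : ContinuousOn s1 (ball (0 : ℂ) 1)
  cP : ContinuousOn P (ball (0 : ℂ) 1)
  f0 : f 0 = 0
  fne : ∀ z ∈ ball (0 : ℂ) 1, z ≠ 0 → f z ≠ 0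
  f10 : f1 0 = 1
  f1ne : ∀ z ∈ ball (0 : ℂ) 1, f1 z ≠ 0
  s0 : s 0 = 1
  P0 : P 0 = 1
  sne : ∀ z ∈ ball (0 : ℂ) 1, s z ≠ 0
  e1 : ∀ z ∈ ball (0 : ℂ) 1, z * f1 z = s z * f z
  e2 : ∀ z ∈ ball (0 : ℂ) 1, z * s1 z = n * s z * (P z - s z)
  mu : ∀ τ : ℝ, 0 ≤ τ → ∀ z ∈ ball (0 : ℂ) 1, ‖z‖ ≤ Real.exp (-τ) →
    ‖1 - ((1 + c) * (Real.exp (-(2 * n * τ)) : ℂ) + (1 - (Real.exp (-(2 * n * τ)) : ℂ)) * P z)‖ < 1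

noncomputable def auxB (n : ℝ) (c : ℂ) (τ : ℝ) : ℂ := (1 + c)⁻¹ * ((Real.exp (2 * n * τ) : ℂ) - 1)

theorem aux_one_add (c : ℂ) (hc : ‖c‖ < 1) : 1 + c ≠ 0 := by
  intro h
  have : c = -1 := by linear_combination h
  simp [this] at hc

theorem auxB_deriv (n : ℝ) (c : ℂ) (τ : ℝ) :
    HasDerivAt (auxB n c) ((1 + c)⁻¹ * (2 * n * Real.exp (2 * n * τ) : ℝ)) τ := by
  unfold auxB
  have h : HasDerivAt (fun t : ℝ => Real.exp (2 * n * t)) (2 * n * Real.exp (2 * n * τ)) τ := by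
    have := ((hasDerivAt_id τ).const_mul (2 * n)).exp
    simpa [mul_comm] using this
  exact (h.ofReal_comp.sub_const 1).const_mul _

theorem auxB_cont (n : ℝ) (c : ℂ) : Continuous (auxB n c) :=
  continuous_iff_continuousAt.2 fun τ => (auxB_deriv n c τ).continuousAt

open Filter in
theorem auxB_tendsto (n : ℝ) (hn : 1 ≤ n) (c : ℂ) (hc : ‖c‖ < 1) :
    Tendsto (fun τ => ‖auxB n c τ‖) atTop atTop := by
  unfold auxB
  have h0 : 0 < ‖(1 + c)⁻¹‖ := norm_pos_iff.2 (inv_ne_zero (aux_one_add c hc))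
  simp only [norm_mul]
  apply Tendsto.const_mul_atTop h0
  have h1 : Tendsto (fun τ : ℝ => Real.exp (2 * n * τ) - 1) atTop atTop := by
    apply tendsto_atTop_add_const_right
    exact Real.tendsto_exp_atTop.comp (tendsto_id.const_mul_atTop (by linarith))
  refine tendsto_atTop_mono (fun τ => ?_) h1
  have := Complex.abs_re_le_norm ((Real.exp (2 * n * τ) : ℂ) - 1)
  simp only [Complex.sub_re, Complex.ofReal_re, Complex.one_re] at this
  exact (le_abs_self _).trans this

theorem auxB_one (n : ℝ) (hn : 1 ≤ n) (c : ℂ) (hc : ‖c‖ < 1) (τ : ℝ) (hτ : 0 ≤ τ) :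
    1 + auxB n c τ ≠ 0 := by
  have h1 := aux_one_add c hc
  have : 1 + auxB n c τ = (1 + c)⁻¹ * (c + (Real.exp (2 * n * τ) : ℂ)) := by
    unfold auxB; field_simp; ring
  rw [this]
  refine mul_ne_zero (inv_ne_zero h1) ?_
  intro h
  have : c = -(Real.exp (2 * n * τ) : ℂ) := by linear_combination h
  rw [this, norm_neg, Complex.norm_real, Real.norm_eq_abs, Real.abs_exp] at hc
  have : 1 ≤ Real.exp (2 * n * τ) := Real.one_le_exp (by positivity)
  linarith

namespace AuxDat

variable {n : ℝ} {c : ℂ} {f f1 s s1 P : ℂ → ℂ}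

theorem key (h : AuxDat n c f f1 s s1 P) (τ : ℝ) (hτ : 0 ≤ τ) (z : ℂ) (hz : z ∈ ball (0:ℂ) 1)
    (hz' : ‖z‖ ≤ Real.exp (-τ)) : 1 + auxB n c τ * P z ≠ 0 ∧
    (((1 + c)⁻¹ * (2 * n * Real.exp (2 * n * τ) : ℝ)) / (-n * (1 + auxB n c τ * P z))).re < -1 := by
  have hμ := h.mu τ hτ z hz hz'
  set μ := 1 - ((1 + c) * (Real.exp (-(2 * n * τ)) : ℂ) + (1 - (Real.exp (-(2 * n * τ)) : ℂ)) * P z)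
    with hμd
  have h1 := aux_one_add c h.hc
  have hE : (Real.exp (2 * n * τ) : ℂ) * (Real.exp (-(2 * n * τ)) : ℂ) = 1 := by
    rw [← Complex.ofReal_mul, ← Real.exp_add]; simp
  set E := (Real.exp (2 * n * τ) : ℂ) with hEd
  have hE0 : E ≠ 0 := left_ne_zero_of_mul_eq_one hE
  have e : 1 + auxB n c τ * P z = (1 + c)⁻¹ * E * (1 - μ) := by
    unfold auxB
    rw [hμd]
    have : (Real.exp (-(2 * n * τ)) : ℂ) = E⁻¹ := by
      exact eq_inv_of_mul_eq_one_right hE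
    rw [this, ← hEd]
    field_simp
    ring
  have hm : 1 - μ ≠ 0 := by
    intro h0
    have : μ = 1 := by linear_combination -h0
    simp [this] at hμ
  have hn0 : (n : ℂ) ≠ 0 := by exact_mod_cast (by linarith [h.hn] : n ≠ 0)
  refine ⟨by rw [e]; exact mul_ne_zero (mul_ne_zero (inv_ne_zero h1) hE0) hm, ?_⟩
  have : ((1 + c)⁻¹ * (2 * n * Real.exp (2 * n * τ) : ℝ)) / (-n * (1 + auxB n c τ * P z))
    = -2 / (1 - μ) := by
    rw [e]
    push_cast
    rw [Complex.ofReal_exp] at hEd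
    push_cast at hEd
    rw [← hEd]
    field_simp
  rw [this]
  exact aux_re μ hμ

theorem s_strict (h : AuxDat n c f f1 s s1 P) (z : ℂ) (hz : z ∈ ball (0:ℂ) 1) :
    HasStrictDerivAt s (s1 z) z :=
  hasStrictDerivAt_of_hasDerivAt_of_continuousAt
    (Filter.eventually_of_mem (isOpen_ball.mem_nhds hz) h.hs) (h.cs1.continuousAt (isOpen_ball.mem_nhds hz))

theorem f_strict (h : AuxDat n c f f1 s s1 P) (z : ℂ) (hz : z ∈ ball (0:ℂ) 1) :
    HasStrictDerivAt f (f1 z) z :=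
  hasStrictDerivAt_of_hasDerivAt_of_continuousAt
    (Filter.eventually_of_mem (isOpen_ball.mem_nhds hz) h.hf) (h.cf1.continuousAt (isOpen_ball.mem_nhds hz))

theorem cs (h : AuxDat n c f f1 s s1 P) : ContinuousOn s (ball (0:ℂ) 1) :=
  fun z hz => (h.hs z hz).continuousAt.continuousWithinAt

theorem cf (h : AuxDat n c f f1 s s1 P) : ContinuousOn f (ball (0:ℂ) 1) :=
  fun z hz => (h.hf z hz).continuousAt.continuousWithinAt

open Filter Topology in
/-- the motion for a function `β = (E - 1)/s`. -/
theorem move (h : AuxDat n c f f1 s s1 P) (τ : ℝ) (hτ : 0 ≤ τ) (z : ℂ) (hz : z ∈ ball (0:ℂ) 1)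
    (hz' : ‖z‖ ≤ Real.exp (-τ)) (hz0 : z ≠ 0) (E : ℂ → ℂ) (E' : ℂ) (hE : HasStrictDerivAt E E' z)
    (hE' : z * E' = - n * s z * E z) (heq : (E z - 1) / s z = auxB n c τ) :
    ∃ Z : ℝ → ℂ, Tendsto Z (𝓝[>] τ) (𝓝 z) ∧
      ∀ᶠ t in 𝓝[>] τ, (E (Z t) - 1) / s (Z t) = auxB n c t ∧ ‖Z t‖ ≤ ‖z‖ * Real.exp (τ - t) := by
  obtain ⟨k1, k2⟩ := h.key τ hτ z hz hz'
  have hs0 := h.sne z hz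
  have hn0 : (n : ℂ) ≠ 0 := by exact_mod_cast (by linarith [h.hn] : n ≠ 0)
  have hd : HasStrictDerivAt (fun x => (E x - 1) / s x) ((E' * s z - (E z - 1) * s1 z) / s z ^ 2) z :=
    HasStrictDerivAt.fun_div (hE.sub_const 1) (h.s_strict z hz) hs0
  have hm : (E' * s z - (E z - 1) * s1 z) / s z ^ 2 * z = -n * (1 + auxB n c τ * P z) := by
    have e2 := h.e2 z hz
    rw [← heq]
    field_simp
    linear_combination s z * hE' - (E z - 1) * e2
  have hb0 : (E' * s z - (E z - 1) * s1 z) / s z ^ 2 ≠ 0 := by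
    intro h0
    rw [h0, zero_mul] at hm
    exact mul_ne_zero (neg_ne_zero.2 hn0) k1 hm.symm
  exact aux_motion _ _ τ _ _ z (auxB_deriv n c τ) hd hb0 heq hz0 (by rw [hm]; exact k2)

open Filter Topology in
theorem nonvanish (h : AuxDat n c f f1 s s1 P) (τ : ℝ) (hτ : 0 ≤ τ) (z : ℂ)
    (hz' : ‖z‖ < Real.exp (-τ)) : 1 + auxB n c τ * s z ≠ 0 := by
  intro h0
  set r := ‖z‖ * Real.exp τ with hr
  have hr1 : r < 1 := by
    calc r < Real.exp (-τ) * Real.exp τ := by rw [hr]; gcongr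
      _ = 1 := by rw [← Real.exp_add]; simp
  have hr0 : 0 ≤ r := by positivity
  set T : Set ℝ := {t | ∃ y, ‖y‖ ≤ r * Real.exp (-t) ∧ 1 + auxB n c t * s y = 0} with hT
  have mem : ∀ t : ℝ, 0 ≤ t → ∀ y : ℂ, ‖y‖ ≤ r * Real.exp (-t) → y ∈ closedBall (0:ℂ) r ∧
      y ∈ ball (0:ℂ) 1 ∧ ‖y‖ ≤ Real.exp (-t) := by
    intro t ht y hy
    have : Real.exp (-t) ≤ 1 := by simpa using ht
    have h2 : 0 < Real.exp (-t) := Real.exp_pos _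
    simp only [mem_closedBall, mem_ball, dist_zero_right]
    refine ⟨?_, ?_, ?_⟩ <;> nlinarith
  have sub : closedBall (0:ℂ) r ⊆ ball 0 1 := closedBall_subset_ball hr1
  have all : ∀ b, Set.Icc τ b ⊆ T := by
    intro b
    apply IsClosed.Icc_subset_of_forall_mem_nhdsWithin
    · -- closed
      set K : Set (ℝ × ℂ) := {p ∈ Set.Icc τ b ×ˢ closedBall (0:ℂ) r |
        ‖p.2‖ ≤ r * Real.exp (-p.1) ∧ 1 + auxB n c p.1 * s p.2 = 0} with hK
      have hc0 : IsClosed (Set.Icc τ b ×ˢ closedBall (0:ℂ) r) := isClosed_Icc.prod isClosed_closedBall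
      have hKc : IsCompact K := by
        refine (isCompact_Icc.prod (isCompact_closedBall (0:ℂ) r)).of_isClosed_subset ?_ (fun p hp => hp.1)
        have c1 : ContinuousOn (fun p : ℝ × ℂ => 1 + auxB n c p.1 * s p.2)
            (Set.Icc τ b ×ˢ closedBall (0:ℂ) r) := by
          have a1 : ContinuousOn (fun p : ℝ × ℂ => s p.2) (Set.Icc τ b ×ˢ closedBall (0:ℂ) r) :=
            h.cs.comp continuousOn_snd (fun p hp => sub hp.2)
          have a2 : Continuous (fun p : ℝ × ℂ => auxB n c p.1) := (auxB_cont n c).comp continuous_fst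
          exact continuousOn_const.add (a2.continuousOn.mul a1)
        have a := c1.preimage_isClosed_of_isClosed hc0 (isClosed_singleton (x := (0:ℂ)))
        have a' : IsClosed {p : ℝ × ℂ | ‖p.2‖ ≤ r * Real.exp (-p.1)} :=
          isClosed_le (by fun_prop) (by fun_prop)
        convert a.inter a' using 1
        ext p
        simp only [hK, Set.mem_ofPred_eq, Set.mem_inter_iff, Set.mem_preimage, Set.mem_singleton_iff]
        tauto
      have : T ∩ Set.Icc τ b = Prod.fst '' K := by
        ext t
        constructor
        · rintro ⟨⟨y, hy1, hy2⟩, ht⟩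
          exact ⟨(t, y), ⟨⟨ht, (mem t (hτ.trans ht.1) y hy1).1⟩, hy1, hy2⟩, rfl⟩
        · rintro ⟨⟨t', y⟩, ⟨hy0, hy1, hy2⟩, rfl⟩
          exact ⟨⟨y, hy1, hy2⟩, hy0.1⟩
      rw [this]
      exact (hKc.image continuous_fst).isClosed
    · refine ⟨z, ?_, h0⟩
      rw [hr, mul_assoc, ← Real.exp_add]; simp
    · rintro t ⟨⟨y, hy1, hy2⟩, ht⟩
      have ht0 : 0 ≤ t := hτ.trans ht.1
      obtain ⟨_, m2, m3⟩ := mem t ht0 y hy1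
      have hy0 : y ≠ 0 := by
        rintro rfl
        rw [h.s0, mul_one] at hy2
        exact auxB_one n h.hn c h.hc t ht0 hy2
      have hsn := h.sne y m2
      obtain ⟨Z, hZ1, hZ2⟩ := h.move t ht0 y m2 m3 hy0 (fun _ => 0) 0 (hasStrictDerivAt_const _ _)
        (by simp) (by field_simp; linear_combination -hy2)
      have hin : ∀ᶠ t' in 𝓝[>] t, Z t' ∈ ball (0:ℂ) 1 := hZ1.eventually (isOpen_ball.mem_nhds m2)
      filter_upwards [hZ2, hin] with t' ⟨b1, b2⟩ b3
      have hsn' := h.sne _ b3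
      refine ⟨Z t', ?_, ?_⟩
      · refine b2.trans ?_
        have : r * Real.exp (-t') = r * Real.exp (-t) * Real.exp (t - t') := by
          rw [mul_assoc r, ← Real.exp_add, show -t + (t - t') = -t' by ring]
        rw [this]
        gcongr
      · rw [← b1]; field_simp; ring
  -- contradiction for large times
  obtain ⟨M, hM⟩ := (isCompact_closedBall (0:ℂ) r).exists_bound_of_continuousOn
    ((h.cs.mono sub).inv₀ (fun y hy => h.sne y (sub hy)))
  obtain ⟨t, ht1, ht2⟩ := (((auxB_tendsto n h.hn c h.hc).eventually_gt_atTop M).and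
    (eventually_ge_atTop τ)).exists
  obtain ⟨y, hy1, hy2⟩ := all t ⟨ht2, le_rfl⟩
  obtain ⟨m1, m2, m3⟩ := mem t (hτ.trans ht2) y hy1
  have hsn := h.sne y m2
  have := hM y m1
  have e : auxB n c t = -(s y)⁻¹ := by field_simp; linear_combination hy2
  rw [e, norm_neg] at ht1
  exact absurd this (not_le.2 ht1)

open Filter Topology in
theorem exists_log (h : AuxDat n c f f1 s s1 P) (r : ℝ) (hr0 : 0 < r) (hr1 : r < 1) :
    ∃ L : ℂ → ℝ → ℂ, Continuous (fun p : ℂ × ℝ => L p.1 p.2) ∧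
      (∀ z, L z 0 = 0) ∧ ∀ t, 0 ≤ t → ∀ z, ‖z‖ ≤ r * Real.exp (-t) →
        Complex.exp (L z t) = 1 + auxB n c t * s z := by
  have hmx : ∀ z : ℂ, 0 < max r ‖z‖ := fun z => lt_max_of_lt_left hr0
  set pr : ℂ → ℂ := fun z => ((r / max r ‖z‖ : ℝ) : ℂ) * z with hpr
  have prc : Continuous pr := by
    have : Continuous (fun z : ℂ => r / max r ‖z‖) :=
      continuous_const.div (by fun_prop) (fun z => (hmx z).ne')
    fun_prop
  have prn : ∀ z, ‖pr z‖ ≤ r := by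
    intro z
    rw [hpr]
    simp only [norm_mul, Complex.norm_real, Real.norm_eq_abs]
    rw [abs_of_pos (div_pos hr0 (hmx z)), div_mul_eq_mul_div, div_le_iff₀ (hmx z)]
    gcongr
    exact le_max_right _ _
  have pri : ∀ z, ‖z‖ ≤ r → pr z = z := by
    intro z hz
    rw [hpr]
    simp only [max_eq_left hz, div_self hr0.ne']
    simp
  set g : ℂ × ℝ → ℂ := fun p => (Real.exp (-(max p.2 0)) : ℂ) * pr p.1 with hg
  have gc : Continuous g := by
    have : Continuous (fun p : ℂ × ℝ => pr p.1) := prc.comp continuous_fst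
    have : Continuous (fun p : ℂ × ℝ => (Real.exp (-(max p.2 0)) : ℂ)) :=
      Complex.continuous_ofReal.comp (by fun_prop)
    fun_prop
  have gn : ∀ p, ‖g p‖ < Real.exp (-(max p.2 0)) := by
    intro p
    rw [hg]
    simp only [norm_mul, Complex.norm_real, Real.norm_eq_abs, Real.abs_exp]
    have := prn p.1
    have h2 : 0 < Real.exp (-(max p.2 0)) := Real.exp_pos _
    nlinarith
  have gb : ∀ p, g p ∈ ball (0:ℂ) 1 := by
    intro p
    rw [mem_ball_zero_iff]
    refine (gn p).trans_le ?_
    simp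
  set V : ℂ × ℝ → ℂ := fun p => 1 + auxB n c (max p.2 0) * s (g p) with hV
  have Vc : Continuous V := by
    have a1 : Continuous (fun p => s (g p)) := by
      rw [continuous_iff_continuousAt]
      intro p
      exact (h.hs _ (gb p)).continuousAt.comp gc.continuousAt
    have a2 : Continuous (fun p : ℂ × ℝ => auxB n c (max p.2 0)) :=
      (auxB_cont n c).comp (by fun_prop)
    exact continuous_const.add (a2.mul a1)
  have V0 : ∀ p, V p ≠ 0 := fun p => h.nonvanish _ (le_max_right _ _) _ (gn p)
  have B0 : auxB n c 0 = 0 := by simp [auxB]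
  obtain ⟨F, ⟨hF0, hF⟩, -⟩ := Complex.isCoveringMapOn_exp.existsUnique_continuousMap_lifts
    (⟨V, Vc⟩ : C(ℂ × ℝ, ℂ)) (a₀ := (0, 0)) (e₀ := 0) (by simp [hV, B0]) (fun p => by simpa using V0 p)
  have hF' : ∀ p, Complex.exp (F p) = V p := fun p => congrFun hF p
  have F0 : ∀ z, F (z, 0) = 0 := by
    intro z
    have hd : ∀ y : ℂ, HasDerivAt (fun y => F (y, 0)) 0 y := by
      intro y
      have := aux_logderiv (fun y => F (y, 0)) (fun _ => 1) 0 y (by fun_prop)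
        (hasDerivAt_const _ _) (Eventually.of_forall fun x => by rw [hF']; simp [hV, B0])
      simpa using this
    have := is_const_of_deriv_eq_zero (fun y => (hd y).differentiableAt) (fun y => (hd y).deriv) z 0
    rw [this, hF0]
  refine ⟨fun z t => F ((Real.exp t : ℂ) * z, t), ?_, ?_, ?_⟩
  · have : Continuous (fun p : ℂ × ℝ => (Real.exp p.2 : ℂ)) :=
      Complex.continuous_ofReal.comp (by fun_prop)
    fun_prop
  · intro z; exact F0 _
  · intro t ht z hz
    simp only
    rw [hF', hV]
    simp only [max_eq_left ht]
    have : g ((Real.exp t : ℂ) * z, t) = z := by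
      rw [hg]
      simp only [max_eq_left ht]
      rw [pri, ← mul_assoc, ← Complex.ofReal_mul, ← Real.exp_add]
      · simp
      · rw [norm_mul, Complex.norm_real, Real.norm_eq_abs, Real.abs_exp]
        have : Real.exp t * ‖z‖ ≤ Real.exp t * (r * Real.exp (-t)) := by gcongr
        refine this.trans (le_of_eq ?_)
        rw [mul_left_comm, ← Real.exp_add]; simp
    rw [this]

end AuxDat

theorem aux_exp_inj (a b : ℂ) (h : Complex.exp a = Complex.exp b) (hn : ‖a - b‖ < 1) : a = b := by
  have h1 : Complex.exp (a - b) = Complex.exp 0 := by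
    rw [Complex.exp_sub, h, div_self (Complex.exp_ne_zero _), Complex.exp_zero]
  have hi := abs_le.1 (Complex.abs_im_le_norm (a - b))
  have hp := Real.pi_gt_three
  have := Complex.exp_inj_of_neg_pi_lt_of_le_pi (by linarith) (by linarith)
    (by simp [Real.pi_pos]) (by simp [Real.pi_pos.le]) h1
  exact sub_eq_zero.1 this

namespace AuxDat

variable {n : ℝ} {c : ℂ} {f f1 s s1 P : ℂ → ℂ}

open Filter Topology in
theorem step (h : AuxDat n c f f1 s s1 P) (r r' : ℝ) (hr0 : 0 ≤ r) (hrr : r < r') (hr1 : r' < 1)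
    (L : ℂ → ℝ → ℂ) (hLc : Continuous (fun p : ℂ × ℝ => L p.1 p.2))
    (hL : ∀ t, 0 ≤ t → ∀ z, ‖z‖ ≤ r' * Real.exp (-t) →
        Complex.exp (L z t) = 1 + auxB n c t * s z)
    (t : ℝ) (ht : 0 ≤ t) (z : ℂ) (hz : ‖z‖ ≤ r * Real.exp (-t)) (hz0 : z ≠ 0) :
    ∃ Z : ℝ → ℂ, Tendsto Z (𝓝[>] t) (𝓝 z) ∧
      ∀ᶠ u in 𝓝[>] t, ‖Z u‖ ≤ r * Real.exp (-u) ∧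
        f (Z u) * Complex.exp (L (Z u) u / n) = f z * Complex.exp (L z t / n) := by
  have hexp : 0 < Real.exp (-t) := Real.exp_pos _
  have hexp1 : Real.exp (-t) ≤ 1 := by simpa using ht
  have hzb : z ∈ ball (0:ℂ) 1 := by rw [mem_ball_zero_iff]; nlinarith
  have hze : ‖z‖ ≤ Real.exp (-t) := by nlinarith
  have hn0 : (n : ℂ) ≠ 0 := by exact_mod_cast (by linarith [h.hn] : n ≠ 0)
  have hfz := h.fne z hzb hz0
  have hsz := h.sne z hzb
  have hLz := hL t ht z (hz.trans (by gcongr))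
  set K : ℂ → ℂ := fun y => L z t + n * Complex.log (f z / f y) with hK
  have Kz : K z = L z t := by simp [hK, div_self hfz]
  have hK1 : HasStrictDerivAt K (n * (-(f1 z / f z))) z := by
    have a1 : HasStrictDerivAt (fun y => f z / f y) ((0 * f z - f z * f1 z) / f z ^ 2) z :=
      HasStrictDerivAt.fun_div (hasStrictDerivAt_const z (f z)) (h.f_strict z hzb) hfz
    have a2 := a1.clog (by rw [div_self hfz]; simp)
    have a3 := (a2.const_mul (n:ℂ)).const_add (L z t)
    have e : (n:ℂ) * ((0 * f z - f z * f1 z) / f z ^ 2 / (f z / f z)) = n * (-(f1 z / f z)) := by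
      field_simp; ring
    rw [e] at a3
    exact a3
  have hE := hK1.cexp
  have he1 := h.e1 z hzb
  obtain ⟨Z, hZ1, hZ2⟩ := h.move t ht z hzb hze hz0 (fun y => Complex.exp (K y)) _ hE
    (by
      field_simp
      linear_combination -he1)
    (by
      simp only [Kz, hLz]
      field_simp
      ring)
  refine ⟨Z, hZ1, ?_⟩
  have hin : ∀ᶠ u in 𝓝[>] t, Z u ∈ ball (0:ℂ) 1 := hZ1.eventually (isOpen_ball.mem_nhds hzb)
  have hnz : ∀ᶠ u in 𝓝[>] t, Z u ≠ 0 := hZ1.eventually_ne hz0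
  have hid : Tendsto (fun u : ℝ => u) (𝓝[>] t) (𝓝 t) := tendsto_id.mono_left nhdsWithin_le_nhds
  have t1 : Tendsto (fun u => L (Z u) u) (𝓝[>] t) (𝓝 (L z t)) :=
    (hLc.tendsto (z, t)).comp (hZ1.prodMk_nhds hid)
  have t2 : Tendsto (fun u => K (Z u)) (𝓝[>] t) (𝓝 (L z t)) := by
    have := hK1.hasDerivAt.continuousAt.tendsto
    rw [Kz] at this
    exact this.comp hZ1
  have t3 : ∀ᶠ u in 𝓝[>] t, ‖L (Z u) u - K (Z u)‖ < 1 := by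
    have := (t1.sub t2).norm
    rw [sub_self, norm_zero] at this
    exact this.eventually_lt_const (by norm_num)
  filter_upwards [hZ2, hin, hnz, t3, self_mem_nhdsWithin] with u ⟨b1, b2⟩ b3 b4 b5 b6
  have hu0 : 0 ≤ u := ht.trans (le_of_lt b6)
  have hfZ := h.fne _ b3 b4
  have hsZ := h.sne _ b3
  have c1 : ‖Z u‖ ≤ r * Real.exp (-u) := by
    refine b2.trans ?_
    have : r * Real.exp (-u) = r * Real.exp (-t) * Real.exp (t - u) := by
      rw [mul_assoc r, ← Real.exp_add, show -t + (t - u) = -u by ring]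
    rw [this]
    gcongr
  refine ⟨c1, ?_⟩
  have c2 : L (Z u) u = K (Z u) := by
    apply aux_exp_inj _ _ _ b5
    rw [hL u hu0 (Z u) (c1.trans (by gcongr)), ← b1]
    field_simp
    ring
  rw [c2, hK]
  simp only
  have : (L z t + n * Complex.log (f z / f (Z u))) / n = L z t / n + Complex.log (f z / f (Z u)) := by
    field_simp
  rw [this, Complex.exp_add, Complex.exp_log (div_ne_zero hfz hfZ)]
  field_simp

open Filter Topology in
theorem inj (h : AuxDat n c f f1 s s1 P) : Set.InjOn f (ball (0:ℂ) 1) := by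
  intro z1 h1 z2 h2 heq
  by_contra hne
  rw [mem_ball_zero_iff] at h1 h2
  obtain ⟨r, hr⟩ : ∃ r, r = max ‖z1‖ ‖z2‖ := ⟨_, rfl⟩
  have hr1 : r < 1 := hr ▸ max_lt h1 h2
  have hr0 : 0 ≤ r := hr ▸ le_max_of_le_left (norm_nonneg _)
  obtain ⟨r', hrr, hr'1⟩ := exists_between hr1
  obtain ⟨L, hLc, hL0, hL⟩ := h.exists_log r' (by linarith) hr'1
  have hn0 : (n : ℂ) ≠ 0 := by exact_mod_cast (by linarith [h.hn] : n ≠ 0)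
  have mem : ∀ t : ℝ, 0 ≤ t → ∀ y : ℂ, ‖y‖ ≤ r * Real.exp (-t) → y ∈ closedBall (0:ℂ) r ∧
      y ∈ ball (0:ℂ) 1 ∧ ‖y‖ ≤ Real.exp (-t) ∧ ‖y‖ < r' * Real.exp (-t) := by
    intro t ht y hy
    have : Real.exp (-t) ≤ 1 := by simpa using ht
    have h2 : 0 < Real.exp (-t) := Real.exp_pos _
    simp only [mem_closedBall, mem_ball, dist_zero_right]
    refine ⟨?_, ?_, ?_, ?_⟩ <;> nlinarith
  have hLd : ∀ t : ℝ, 0 ≤ t → ∀ y : ℂ, ‖y‖ ≤ r * Real.exp (-t) →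
      HasDerivAt (fun x => L x t) (auxB n c t * s1 y / (1 + auxB n c t * s y)) y := by
    intro t ht y hy
    obtain ⟨_, m2, _, m4⟩ := mem t ht y hy
    refine aux_logderiv (fun x => L x t) (fun x => 1 + auxB n c t * s x) _ y ?_ ?_ ?_
    · exact (hLc.comp (continuous_id.prodMk continuous_const)).continuousAt
    · exact ((h.hs y m2).const_mul _).const_add _
    · have : ∀ᶠ x in 𝓝 y, ‖x‖ < r' * Real.exp (-t) :=
        continuous_norm.continuousAt.eventually_lt continuousAt_const m4
      filter_upwards [this] with x hx
      exact hL t ht x hx.le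
  set G : ℂ → ℝ → ℂ := fun z t => f z * Complex.exp (L z t / n) with hG
  set D : ℂ → ℝ → ℂ := fun z t => f1 z * Complex.exp (L z t / n) *
    ((1 + auxB n c t * P z) / (1 + auxB n c t * s z)) with hD
  have hnv : ∀ t : ℝ, 0 ≤ t → ∀ y : ℂ, ‖y‖ ≤ r * Real.exp (-t) → 1 + auxB n c t * s y ≠ 0 := by
    intro t ht y hy
    obtain ⟨_, m2, _, m4⟩ := mem t ht y hy
    rw [← hL t ht y m4.le]
    exact Complex.exp_ne_zero _
  have hGD : ∀ t : ℝ, 0 ≤ t → ∀ y : ℂ, ‖y‖ ≤ r * Real.exp (-t) →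
      HasDerivAt (fun x => G x t) (D y t) y := by
    intro t ht y hy
    obtain ⟨_, m2, _, m4⟩ := mem t ht y hy
    have nv := hnv t ht y hy
    have e3 : f y * s1 y = n * f1 y * (P y - s y) := by
      rcases eq_or_ne y 0 with rfl | hy0
      · simp [h.f0, h.P0, h.s0]
      · apply mul_left_cancel₀ hy0
        linear_combination f y * h.e2 y m2 - n * (P y - s y) * h.e1 y m2
    have := (h.hf y m2).mul ((hLd t ht y hy).div_const (n:ℂ)).cexp
    refine HasDerivAt.congr_deriv this ?_
    rw [hD]
    simp only
    field_simp
    linear_combination (auxB n c t) * e3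
  have hGc : ∀ t : ℝ, ∀ y ∈ ball (0:ℂ) 1, ContinuousAt (fun p : ℂ × ℝ => G p.1 p.2) (y, t) := by
    intro t y hy
    have a1 : ContinuousAt (fun p : ℂ × ℝ => f p.1) (y, t) :=
      ContinuousAt.comp (f := Prod.fst) (h.hf y hy).continuousAt continuousAt_fst
    exact a1.mul (by fun_prop)
  have hDc : ∀ t : ℝ, 0 ≤ t → ∀ y : ℂ, ‖y‖ ≤ r * Real.exp (-t) →
      ContinuousAt (fun p : ℂ × ℝ => D p.1 p.2) (y, t) := by
    intro t ht y hy
    obtain ⟨_, m2, _, m4⟩ := mem t ht y hy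
    have nb := isOpen_ball.mem_nhds m2
    have a1 : ContinuousAt (fun p : ℂ × ℝ => f1 p.1) (y, t) :=
      ContinuousAt.comp (f := Prod.fst) (h.cf1.continuousAt nb) continuousAt_fst
    have a2 : ContinuousAt (fun p : ℂ × ℝ => P p.1) (y, t) :=
      ContinuousAt.comp (f := Prod.fst) (h.cP.continuousAt nb) continuousAt_fst
    have a3 : ContinuousAt (fun p : ℂ × ℝ => s p.1) (y, t) :=
      ContinuousAt.comp (f := Prod.fst) (h.cs.continuousAt nb) continuousAt_fst
    have a4 : ContinuousAt (fun p : ℂ × ℝ => auxB n c p.2) (y, t) :=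
      ((auxB_cont n c).comp continuous_snd).continuousAt
    have a5 : ContinuousAt (fun p : ℂ × ℝ => Complex.exp (L p.1 p.2 / n)) (y, t) := by fun_prop
    exact (a1.mul a5).mul ((continuousAt_const.add (a4.mul a2)).div
      (continuousAt_const.add (a4.mul a3)) (hnv t ht y hy))
  have hDn : ∀ t : ℝ, 0 ≤ t → ∀ y : ℂ, ‖y‖ ≤ r * Real.exp (-t) → D y t ≠ 0 := by
    intro t ht y hy
    obtain ⟨_, m2, m3, m4⟩ := mem t ht y hy
    exact mul_ne_zero (mul_ne_zero (h.f1ne y m2) (Complex.exp_ne_zero _))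
      (div_ne_zero (h.key t ht y m2 m3).1 (hnv t ht y hy))
  set T : Set ℝ := {t | ∃ y1 y2, ‖y1‖ ≤ r * Real.exp (-t) ∧ ‖y2‖ ≤ r * Real.exp (-t) ∧ y1 ≠ y2 ∧
    G y1 t = G y2 t} with hT
  have all : ∀ b, Set.Icc 0 b ⊆ T := by
    intro b
    apply IsClosed.Icc_subset_of_forall_mem_nhdsWithin
    · apply IsSeqClosed.isClosed
      intro u t hu hut
      have ht : t ∈ Set.Icc 0 b := isClosed_Icc.mem_of_tendsto hut (Eventually.of_forall fun k => (hu k).2)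
      refine ⟨?_, ht⟩
      have hu0 : ∀ k, 0 ≤ u k := fun k => (hu k).2.1
      choose y1 y2 hy1 hy2 hyne hyG using fun k => (hu k).1
      obtain ⟨⟨a1, a2⟩, -, φ, hφ, hlim⟩ := ((isCompact_closedBall (0:ℂ) r).prod
        (isCompact_closedBall (0:ℂ) r)).tendsto_subseq (x := fun k => (y1 k, y2 k))
        (fun k => ⟨(mem _ (hu0 k) _ (hy1 k)).1, (mem _ (hu0 k) _ (hy2 k)).1⟩)
      have l1 : Tendsto (fun k => y1 (φ k)) atTop (𝓝 a1) := (continuous_fst.tendsto _).comp hlim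
      have l2 : Tendsto (fun k => y2 (φ k)) atTop (𝓝 a2) := (continuous_snd.tendsto _).comp hlim
      have lu : Tendsto (fun k => u (φ k)) atTop (𝓝 t) := hut.comp hφ.tendsto_atTop
      have le : Tendsto (fun k => r * Real.exp (-(u (φ k)))) atTop (𝓝 (r * Real.exp (-t))) := by
        have : Continuous (fun t : ℝ => r * Real.exp (-t)) := by fun_prop
        exact (this.tendsto t).comp lu
      have n1 : ‖a1‖ ≤ r * Real.exp (-t) := le_of_tendsto_of_tendsto' l1.norm le (fun k => hy1 _)
      have n2 : ‖a2‖ ≤ r * Real.exp (-t) := le_of_tendsto_of_tendsto' l2.norm le (fun k => hy2 _)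
      have g1 : Tendsto (fun k => G (y1 (φ k)) (u (φ k))) atTop (𝓝 (G a1 t)) :=
        (hGc t a1 (mem t ht.1 a1 n1).2.1).tendsto.comp (l1.prodMk_nhds lu)
      have g2 : Tendsto (fun k => G (y2 (φ k)) (u (φ k))) atTop (𝓝 (G a2 t)) :=
        (hGc t a2 (mem t ht.1 a2 n2).2.1).tendsto.comp (l2.prodMk_nhds lu)
      have hGG : G a1 t = G a2 t := by
        refine tendsto_nhds_unique g1 (g2.congr fun k => (hyG _).symm)
      refine ⟨a1, a2, n1, n2, ?_, hGG⟩
      rintro rfl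
      have d0 := hDn t ht.1 a1 n1
      have d1 : ∀ᶠ p : ℂ × ℝ in 𝓝 a1 ×ˢ 𝓝 t, ‖D p.1 p.2 - D a1 t‖ < ‖D a1 t‖ / 2 := by
        rw [← nhds_prod_eq]
        have : ContinuousAt (fun p : ℂ × ℝ => ‖D p.1 p.2 - D a1 t‖) (a1, t) :=
          ((hDc t ht.1 a1 n1).sub continuousAt_const).norm
        refine this.eventually_lt continuousAt_const ?_
        simp only [sub_self, norm_zero]
        have := norm_pos_iff.2 d0
        positivity
      obtain ⟨pa, hpa, pb, hpb, hpp⟩ := eventually_prod_iff.1 d1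
      obtain ⟨ε, hε, hball⟩ := Metric.eventually_nhds_iff_ball.1 hpa
      obtain ⟨k, k1, k2, k3⟩ := ((l1.eventually (ball_mem_nhds a1 hε)).and
        ((l2.eventually (ball_mem_nhds a1 hε)).and (lu.eventually hpb))).exists
      have conv : Convex ℝ (ball a1 ε ∩ closedBall (0:ℂ) (r * Real.exp (-(u (φ k))))) :=
        (convex_ball _ _).inter (convex_closedBall _ _)
      have := aux_inj _ conv (fun x => G x (u (φ k))) (fun x => D x (u (φ k))) (D a1 t) (‖D a1 t‖ / 2)
        (fun x hx => hGD _ (hu0 _) x (mem_closedBall_zero_iff.1 hx.2))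
        (fun x hx => (hpp (hball x hx.1) k3).le)
        (by have := norm_pos_iff.2 d0; linarith)
      exact hyne _ (this ⟨k1, mem_closedBall_zero_iff.2 (hy1 _)⟩
        ⟨k2, mem_closedBall_zero_iff.2 (hy2 _)⟩ (hyG _))
    · refine ⟨z1, z2, ?_, ?_, hne, ?_⟩
      · simp [hr]
      · simp [hr]
      · simp [hG, hL0, heq]
    · rintro t ⟨⟨y1, y2, n1, n2, hyne, hyG⟩, ht⟩
      have hz : ∀ y, ‖y‖ ≤ r * Real.exp (-t) → G y t = 0 → y = 0 := by
        intro y hy h0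
        by_contra hy0
        exact mul_ne_zero (h.fne y (mem t ht.1 y hy).2.1 hy0) (Complex.exp_ne_zero _) h0
      have hG0 : G 0 t = 0 := by simp [hG, h.f0]
      have z1 : y1 ≠ 0 := by
        rintro rfl
        exact hyne (hz y2 n2 (hyG ▸ hG0)).symm
      have z2 : y2 ≠ 0 := by
        rintro rfl
        exact hyne (hz y1 n1 (hyG.trans hG0))
      obtain ⟨Z1, p1, p2⟩ := h.step r r' hr0 hrr hr'1 L hLc hL t ht.1 y1 n1 z1
      obtain ⟨Z2, q1, q2⟩ := h.step r r' hr0 hrr hr'1 L hLc hL t ht.1 y2 n2 z2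
      have hne' : ∀ᶠ u in 𝓝[>] t, Z1 u ≠ Z2 u := by
        have := (p1.sub q1).eventually_ne (sub_ne_zero.2 hyne)
        filter_upwards [this] with u hu
        exact sub_ne_zero.1 hu
      filter_upwards [p2, q2, hne'] with u ⟨b1, b2⟩ ⟨c1, c2⟩ b3
      exact ⟨Z1 u, Z2 u, b1, c1, b3, b2.trans (hyG.trans c2.symm)⟩
  -- large times
  have z0 : (0:ℂ) ∈ ball (0:ℂ) 1 := by simp
  have nb := isOpen_ball.mem_nhds z0
  have Bi : Tendsto (fun t => (auxB n c t)⁻¹) atTop (𝓝 0) := by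
    rw [tendsto_zero_iff_norm_tendsto_zero]
    simp only [norm_inv]
    exact (auxB_tendsto n h.hn c h.hc).inv_tendsto_atTop
  have Bi' : Tendsto (fun p : ℝ × ℂ => (auxB n c p.1)⁻¹) (atTop ×ˢ 𝓝 0) (𝓝 0) := Bi.comp tendsto_fst
  have ts : Tendsto (fun p : ℝ × ℂ => (auxB n c p.1)⁻¹ + s p.2) (atTop ×ˢ 𝓝 0) (𝓝 1) := by
    have a : Tendsto (fun p : ℝ × ℂ => s p.2) (atTop ×ˢ 𝓝 0) (𝓝 1) := by
      have := (h.cs.continuousAt nb).tendsto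
      rw [h.s0] at this
      exact this.comp tendsto_snd
    simpa using Bi'.add a
  have tP : Tendsto (fun p : ℝ × ℂ => (auxB n c p.1)⁻¹ + P p.2) (atTop ×ˢ 𝓝 0) (𝓝 1) := by
    have a : Tendsto (fun p : ℝ × ℂ => P p.2) (atTop ×ˢ 𝓝 0) (𝓝 1) := by
      have := (h.cP.continuousAt nb).tendsto
      rw [h.P0] at this
      exact this.comp tendsto_snd
    simpa using Bi'.add a
  have tf : Tendsto (fun p : ℝ × ℂ => f1 p.2) (atTop ×ˢ 𝓝 0) (𝓝 1) := by
    have := (h.cf1.continuousAt nb).tendsto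
    rw [h.f10] at this
    exact this.comp tendsto_snd
  have ts1 : Tendsto (fun p : ℝ × ℂ => s1 p.2) (atTop ×ˢ 𝓝 0) (𝓝 (s1 0)) :=
    ((h.cs1.continuousAt nb).tendsto).comp tendsto_snd
  set M := ‖s1 0‖ + 1 with hM
  have ev1 : ∀ᶠ p : ℝ × ℂ in atTop ×ˢ 𝓝 0, ‖s1 p.2 / ((auxB n c p.1)⁻¹ + s p.2)‖ < M := by
    have := (ts1.div ts one_ne_zero).norm
    refine this.eventually_lt_const ?_
    simp [hM]
  have ev2 : ∀ᶠ x : (ℝ × ℂ) × ℂ in (atTop ×ˢ 𝓝 0) ×ˢ 𝓝 0,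
      ‖f1 x.1.2 * Complex.exp x.2 * (((auxB n c x.1.1)⁻¹ + P x.1.2) / ((auxB n c x.1.1)⁻¹ + s x.1.2)) - 1‖
        < 1 / 2 := by
    have a1 : Tendsto (fun x : (ℝ × ℂ) × ℂ => Complex.exp x.2) ((atTop ×ˢ 𝓝 0) ×ˢ 𝓝 0) (𝓝 1) := by
      have := (Complex.continuous_exp.tendsto 0)
      rw [Complex.exp_zero] at this
      exact this.comp tendsto_snd
    have a2 := (((tf.comp tendsto_fst).mul a1).mul
      ((tP.comp tendsto_fst).div (ts.comp tendsto_fst) one_ne_zero)).sub_const 1 |>.norm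
    refine a2.eventually_lt_const ?_
    simp
  obtain ⟨pa, hpa, pb, hpb, hpp⟩ := eventually_prod_iff.1 ev2
  obtain ⟨qa, hqa, qb, hqb, hqq⟩ := eventually_prod_iff.1 (ev1.and hpa)
  obtain ⟨ε, hε, hball⟩ := Metric.eventually_nhds_iff_ball.1 hqb
  obtain ⟨δ, hδ, hball'⟩ := Metric.eventually_nhds_iff_ball.1 hpb
  have te : Tendsto (fun t : ℝ => r * Real.exp (-t)) atTop (𝓝 0) := by
    simpa using Real.tendsto_exp_neg_atTop_nhds_zero.const_mul r
  have te' : Tendsto (fun t : ℝ => M * (r * Real.exp (-t)) / n) atTop (𝓝 0) := by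
    simpa using (te.const_mul M).div_const n
  obtain ⟨t, t1, t2, t3, t4, t5⟩ := (hqa.and ((te.eventually_lt_const hε).and
    ((te'.eventually_lt_const hδ).and ((eventually_ge_atTop 0).and
      ((auxB_tendsto n h.hn c h.hc).eventually_gt_atTop 0))))).exists
  have hB : auxB n c t ≠ 0 := norm_pos_iff.1 t5
  have hM0 : 0 ≤ M := by positivity
  have hnpos : 0 < n := by linarith [h.hn]
  have R0 : 0 ≤ r * Real.exp (-t) := by positivity
  have pt : ∀ y : ℂ, ‖y‖ ≤ r * Real.exp (-t) →
      ‖s1 y / ((auxB n c t)⁻¹ + s y)‖ < M ∧ pa (t, y) := by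
    intro y hy
    exact hqq t1 (hball y (by rw [mem_ball_zero_iff]; linarith))
  have hLL : ∀ y : ℂ, ‖y‖ ≤ r * Real.exp (-t) → ‖L y t - L 0 t‖ ≤ M * ‖y‖ := by
    intro y hy
    have := (convex_closedBall (0:ℂ) (r * Real.exp (-t))).norm_image_sub_le_of_norm_hasDerivWithin_le
      (f := fun x => L x t) (C := M) (x := 0) (y := y)
      (fun x hx => (hLd t t4 x (mem_closedBall_zero_iff.1 hx)).hasDerivWithinAt)
      (fun x hx => by
        have hx' := mem_closedBall_zero_iff.1 hx
        have a := (pt x hx').1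
        have nv := hnv t t4 x hx'
        have e : auxB n c t * s1 x / (1 + auxB n c t * s x) = s1 x / ((auxB n c t)⁻¹ + s x) := by
          have : (auxB n c t)⁻¹ + s x = (auxB n c t)⁻¹ * (1 + auxB n c t * s x) := by field_simp
          rw [this]
          field_simp
        rw [e]
        exact a.le) (by simpa using R0) (mem_closedBall_zero_iff.2 hy)
    simpa using this
  have injG := aux_inj (closedBall (0:ℂ) (r * Real.exp (-t))) (convex_closedBall _ _)
    (fun x => G x t) (fun x => D x t) (Complex.exp (L 0 t / n)) (‖Complex.exp (L 0 t / n)‖ / 2)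
    (fun x hx => hGD t t4 x (mem_closedBall_zero_iff.1 hx))
    (fun x hx => by
      have hx' := mem_closedBall_zero_iff.1 hx
      have nv := hnv t t4 x hx'
      have v : ‖(L x t - L 0 t) / n‖ < δ := by
        rw [norm_div, Complex.norm_real, Real.norm_of_nonneg hnpos.le]
        refine lt_of_le_of_lt ?_ t3
        gcongr
        exact (hLL x hx').trans (by gcongr)
      have a := hpp (pt x hx').2 (hball' ((L x t - L 0 t) / n) (by rwa [mem_ball_zero_iff]))
      simp only at a
      have e : D x t - Complex.exp (L 0 t / n) = Complex.exp (L 0 t / n) *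
        (f1 x * Complex.exp ((L x t - L 0 t) / n) *
          (((auxB n c t)⁻¹ + P x) / ((auxB n c t)⁻¹ + s x)) - 1) := by
        have e1 : Complex.exp (L x t / n) = Complex.exp (L 0 t / n) * Complex.exp ((L x t - L 0 t) / n) := by
          rw [← Complex.exp_add]; congr 1; ring
        have e2 : ((auxB n c t)⁻¹ + P x) / ((auxB n c t)⁻¹ + s x)
          = (1 + auxB n c t * P x) / (1 + auxB n c t * s x) := by
          have a1 : (auxB n c t)⁻¹ + s x = (auxB n c t)⁻¹ * (1 + auxB n c t * s x) := by field_simp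
          have a2 : (auxB n c t)⁻¹ + P x = (auxB n c t)⁻¹ * (1 + auxB n c t * P x) := by field_simp
          rw [a1, a2, mul_div_mul_left _ _ (inv_ne_zero hB)]
        rw [e2, hD]
        simp only
        rw [e1]
        ring
      rw [e, norm_mul]
      have := norm_nonneg (Complex.exp (L 0 t / n))
      nlinarith)
    (by have := norm_pos_iff.2 (Complex.exp_ne_zero (L 0 t / n)); linarith)
  obtain ⟨y1, y2, n1, n2, hyne, hyG⟩ := all t ⟨t4, le_rfl⟩
  exact hyne (injG (mem_closedBall_zero_iff.2 n1) (mem_closedBall_zero_iff.2 n2) hyG)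

end AuxDat

theorem final_w (lam : ℝ) (P : ℂ) (hcos : 0 < Real.cos lam)
    (hre : 0 < (Complex.exp (-(lam : ℂ) * Complex.I) * P).re) :
    (Complex.exp (-(lam : ℂ) * Complex.I) * P + Complex.exp ((lam : ℂ) * Complex.I)) ≠ 0 ∧
    ‖(Complex.exp (-(lam : ℂ) * Complex.I) * P - Complex.exp (-(lam : ℂ) * Complex.I)) /
      (Complex.exp (-(lam : ℂ) * Complex.I) * P + Complex.exp ((lam : ℂ) * Complex.I))‖ < 1 := by
  have r1 : (Complex.exp ((lam : ℂ) * Complex.I)).re = Real.cos lam := Complex.exp_ofReal_mul_I_re lam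
  have i1 : (Complex.exp ((lam : ℂ) * Complex.I)).im = Real.sin lam := Complex.exp_ofReal_mul_I_im lam
  have r2 : (Complex.exp (-(lam : ℂ) * Complex.I)).re = Real.cos lam := by
    have := Complex.exp_ofReal_mul_I_re (-lam)
    rw [Real.cos_neg] at this
    simpa using this
  have i2 : (Complex.exp (-(lam : ℂ) * Complex.I)).im = -Real.sin lam := by
    have := Complex.exp_ofReal_mul_I_im (-lam)
    rw [Real.sin_neg] at this
    simpa using this
  set Q := Complex.exp (-(lam : ℂ) * Complex.I) * P
  have h0 : Q + Complex.exp ((lam : ℂ) * Complex.I) ≠ 0 := by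
    intro h
    have := congrArg Complex.re h
    rw [Complex.add_re, r1, Complex.zero_re] at this
    linarith
  refine ⟨h0, ?_⟩
  rw [norm_div, div_lt_one (norm_pos_iff.2 h0)]
  apply lt_of_pow_lt_pow_left₀ 2 (norm_nonneg _)
  rw [← Complex.normSq_eq_norm_sq, ← Complex.normSq_eq_norm_sq, Complex.normSq_apply,
    Complex.normSq_apply, Complex.sub_re, Complex.sub_im, Complex.add_re, Complex.add_im, r1, r2, i1, i2]
  nlinarith [mul_pos hre hcos]

theorem final_mu (lam n τ : ℝ) (z : ℂ) (P : ℂ → ℂ) (hcos : 0 < Real.cos lam) (hn : 1 ≤ n)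
    (hnc : n * Real.cos lam < 1)
    (hP : DifferentiableOn ℂ P (ball (0 : ℂ) 1)) (hP0 : P 0 = 1) (hP1 : HasDerivAt P 0 0)
    (hre : ∀ z ∈ ball (0 : ℂ) 1, 0 < (Complex.exp (-(lam : ℂ) * Complex.I) * P z).re)
    (hτ : 0 ≤ τ) (hz : z ∈ ball (0 : ℂ) 1) (hzτ : ‖z‖ ≤ Real.exp (-τ)) :
    ‖1 - ((1 + (-(n * Real.cos lam : ℝ) * Complex.exp ((lam : ℂ) * Complex.I))) *
      (Real.exp (-(2 * n * τ)) : ℂ) + (1 - (Real.exp (-(2 * n * τ)) : ℂ)) * P z)‖ < 1 := by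
  set A := Complex.exp (-(lam : ℂ) * Complex.I) with hA
  set a := Complex.exp ((lam : ℂ) * Complex.I) with ha
  have haA : a * A = 1 := by
    rw [ha, hA, ← Complex.exp_add]; simp
  have hsum : A + a = 2 * (Real.cos lam : ℂ) := by
    rw [Complex.ofReal_cos, Complex.two_cos]
    rw [hA, ha]; ring
  have hcosC : (Real.cos lam : ℂ) ≠ 0 := by exact_mod_cast hcos.ne'
  set w : ℂ → ℂ := fun z => (A * P z - A) / (A * P z + a) with hw
  have hne : ∀ z ∈ ball (0 : ℂ) 1, A * P z + a ≠ 0 := fun z hz => (final_w lam (P z) hcos (hre z hz)).1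
  have hlt : ∀ z ∈ ball (0 : ℂ) 1, ‖w z‖ < 1 := fun z hz => (final_w lam (P z) hcos (hre z hz)).2
  have hwd : DifferentiableOn ℂ w (ball (0 : ℂ) 1) :=
    ((hP.const_mul A).sub_const A).div ((hP.const_mul A).add_const a) hne
  have hw0 : w 0 = 0 := by simp [hw, hP0]
  have m0 : (0 : ℂ) ∈ ball (0 : ℂ) 1 := by simp
  have hw1 : HasDerivAt w 0 0 := by
    have := ((hP1.const_mul A).sub_const A).div ((hP1.const_mul A).add_const a) (hne 0 m0)
    have h2 := this.congr_deriv (g' := 0) (by simp)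
    exact h2
  have hsch : ‖w z‖ ≤ ‖z‖ ^ 2 := by
    have := Complex.dist_le_mul_div_pow_of_mapsTo_ball_of_isLittleO (n := 1) (f := w) (c := 0)
      (R₁ := 1) (R₂ := 1) hwd (fun y hy => by
        rw [hw0, mem_closedBall_zero_iff]; exact (hlt y hy).le) (by
        have := hw1.isLittleO
        simp only [hw0, sub_zero, pow_one]
        rw [Asymptotics.isLittleO_norm_right]
        simpa [hw0] using this) hz
    simpa [hw0] using this
  have hwy : ‖w z‖ ≤ Real.exp (-(2 * τ)) := by
    refine hsch.trans ?_
    calc ‖z‖ ^ 2 ≤ Real.exp (-τ) ^ 2 := by gcongr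
      _ = _ := by rw [← Real.exp_nat_mul]; congr 1; push_cast; ring
  have hb := aux_bound n (2 * τ) hn (by positivity) (w z) hwy (hlt z hz)
  have hX : Real.exp (-(n * (2 * τ))) = Real.exp (-(2 * n * τ)) := by congr 1; ring
  rw [hX] at hb
  set X := Real.exp (-(2 * n * τ))
  have hw1ne : 1 - w z ≠ 0 := by
    intro h
    have h1 : w z = 1 := (sub_eq_zero.1 h).symm
    have := hlt z hz
    rw [h1] at this; simp at this
  have hPe : P z - 1 = 2 * (Real.cos lam : ℂ) * a * (w z / (1 - w z)) := by
    have h1 : 1 - w z = 2 * (Real.cos lam : ℂ) / (A * P z + a) := by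
      rw [eq_div_iff (hne z hz), sub_mul, hw]
      simp only []
      rw [div_mul_cancel₀ _ (hne z hz), ← hsum]; ring
    have h2 : w z / (1 - w z) = (A * P z - A) / (2 * (Real.cos lam : ℂ)) := by
      rw [h1]
      simp only [hw]
      rw [div_div_div_cancel_right₀ (hne z hz)]
    rw [h2]
    field_simp
    linear_combination (1 - P z) * haA
  have hE : 1 - ((1 + (-((n * Real.cos lam : ℝ) : ℂ) * a)) * (X : ℂ) + (1 - (X : ℂ)) * P z)
      = -(2 * (Real.cos lam : ℂ) * a) * (-((n / 2 * X : ℝ) : ℂ) + ((1 - X : ℝ) : ℂ) * (w z / (1 - w z))) := by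
    rw [Complex.ofReal_mul n, Complex.ofReal_mul, Complex.ofReal_div, Complex.ofReal_sub,
      Complex.ofReal_one, Complex.ofReal_ofNat]
    linear_combination -(1 - (X : ℂ)) * hPe
  rw [hE, norm_mul]
  have hna : ‖-(2 * (Real.cos lam : ℂ) * a)‖ = 2 * Real.cos lam := by
    rw [norm_neg, norm_mul, norm_mul, ha, Complex.norm_exp_ofReal_mul_I, Complex.norm_real,
      Real.norm_of_nonneg hcos.le]
    simp
  rw [hna]
  calc _ ≤ 2 * Real.cos lam * (n / 2) := by gcongr
    _ = n * Real.cos lam := by ring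
    _ < 1 := hnc

theorem final_dat (lam : ℝ)
    (q : ℝ) (hq : 0 < q)
    (hcos : 0 < Real.cos lam) (hcos2 : Real.cos lam < 1 / (1 + 2 * q))
    (f : ℂ → ℂ)
    (hf : DifferentiableOn ℂ f (ball (0 : ℂ) 1))
    (hf0 : f 0 = 0) (hf'0 : deriv f 0 = 1)
    (hf''0 : deriv (deriv f) 0 = 0)
    (hf' : ∀ z ∈ ball (0 : ℂ) 1, deriv f z ≠ 0)
    (hfne : ∀ z ∈ ball (0 : ℂ) 1, z ≠ 0 → f z ≠ 0)
    (hcond : ∀ z ∈ ball (0 : ℂ) 1,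
      0 < (Complex.exp (-(lam : ℂ) * Complex.I) *
        (1 + z * deriv (deriv f) z / deriv f z +
          (q : ℂ) * (if z = 0 then 1 else z * deriv f z / f z))).re) :
    Set.InjOn f (ball (0 : ℂ) 1) := by
  have ho : IsOpen (ball (0 : ℂ) 1) := isOpen_ball
  have m0 : (0 : ℂ) ∈ ball (0 : ℂ) 1 := by simp
  have dAt : ∀ {F : ℂ → ℂ}, DifferentiableOn ℂ F (ball (0 : ℂ) 1) → ∀ z ∈ ball (0 : ℂ) 1,
      HasDerivAt F (deriv F z) z := fun hF z hz =>
    ((hF z hz).differentiableAt (ho.mem_nhds hz)).hasDerivAt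
  have hd1 := hf.deriv ho
  have hd2 := hd1.deriv ho
  obtain ⟨g, hg⟩ : ∃ g, g = dslope f 0 := ⟨_, rfl⟩
  have hgd : DifferentiableOn ℂ g (ball (0 : ℂ) 1) := by
    rw [hg]; exact (Complex.differentiableOn_dslope (ho.mem_nhds m0)).2 hf
  have hfg : f = fun z => z * g z := by
    funext z
    have := sub_smul_dslope f 0 z
    rw [hg]
    simpa [hf0] using this.symm
  have hg0 : g 0 = 1 := by rw [hg, dslope_same, hf'0]
  have hgne : ∀ z ∈ ball (0 : ℂ) 1, g z ≠ 0 := by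
    intro z hz h
    by_cases h0 : z = 0
    · rw [h0, hg0] at h; exact one_ne_zero h
    · apply hfne z hz h0
      rw [hfg]; simp [h]
  have hg' : ∀ z ∈ ball (0 : ℂ) 1, z * deriv g z = deriv f z - g z := by
    intro z hz
    have h1 := (hasDerivAt_id z).mul (dAt hgd z hz)
    have h2 : HasDerivAt f (1 * g z + z * deriv g z) z := by
      rw [hfg]; exact h1
    have := h2.unique (dAt hf z hz)
    linear_combination this
  have hgd1 := hgd.deriv ho
  have hg'0 : deriv g 0 = 0 := by
    have h1 := (hasDerivAt_id (0 : ℂ)).mul (dAt hgd1 0 m0)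
    have h2 := (dAt hd1 0 m0).sub (dAt hgd 0 m0)
    have h3 : HasDerivAt (fun z => deriv f z - g z) (1 * deriv g 0 + 0 * deriv (deriv g) 0) 0 := by
      refine h1.congr_of_eventuallyEq ?_
      filter_upwards [ho.mem_nhds m0] with z hz
      exact (hg' z hz).symm
    have h4 := h3.unique h2
    rw [hf''0] at h4
    linear_combination h4 / 2
  obtain ⟨s, hs⟩ : ∃ s : ℂ → ℂ, s = fun z => deriv f z / g z := ⟨_, rfl⟩
  have hsv : ∀ z, s z = deriv f z / g z := fun z => by rw [hs]
  have hsd : DifferentiableOn ℂ s (ball (0 : ℂ) 1) := by rw [hs]; exact hd1.div hgd hgne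
  have hs1 : ∀ z ∈ ball (0 : ℂ) 1, deriv s z =
      (deriv (deriv f) z * g z - deriv f z * deriv g z) / g z ^ 2 := by
    intro z hz
    have := (dAt hd1 z hz).div (dAt hgd z hz) (hgne z hz)
    rw [hs]
    exact this.deriv
  have hs10 : deriv s 0 = 0 := by rw [hs1 0 m0, hf''0, hg'0]; simp
  have hs0 : s 0 = 1 := by rw [hsv, hf'0, hg0, div_one]
  obtain ⟨P, hP⟩ : ∃ P : ℂ → ℂ, P = fun z =>
    (1 + z * (deriv (deriv f) z / deriv f z) + (q : ℂ) * s z) / ((1 + q : ℝ) : ℂ) := ⟨_, rfl⟩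
  have hPv : ∀ z, P z = (1 + z * (deriv (deriv f) z / deriv f z) + (q : ℂ) * s z) / ((1 + q : ℝ) : ℂ) :=
    fun z => by rw [hP]
  have hn0 : ((1 + q : ℝ) : ℂ) ≠ 0 := by
    have : (1 + q : ℝ) ≠ 0 := by positivity
    exact_mod_cast this
  have hdd := hd2.div hd1 hf'
  have hPd : DifferentiableOn ℂ P (ball (0 : ℂ) 1) := by
    rw [hP]
    exact (((differentiableOn_id.mul hdd).const_add 1).add (hsd.const_mul _)).div_const _
  have hP0 : P 0 = 1 := by
    rw [hPv, hs0, div_eq_one_iff_eq hn0]; push_cast; ring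
  have hP1 : HasDerivAt P 0 0 := by
    have h1 := ((((hasDerivAt_id (0 : ℂ)).mul (dAt hdd 0 m0)).const_add 1).add
      ((dAt hsd 0 m0).const_mul (q : ℂ))).div_const ((1 + q : ℝ) : ℂ)
    have h2 := h1.congr_deriv (g' := 0) (by simp [hs10, hf''0])
    rw [hP]
    exact h2
  have hfz : ∀ z, f z = z * g z := fun z => by rw [hfg]
  have hre : ∀ z ∈ ball (0 : ℂ) 1, 0 < (Complex.exp (-(lam : ℂ) * Complex.I) * P z).re := by
    intro z hz
    have h1 := hcond z hz
    have h2 : (if z = 0 then 1 else z * deriv f z / f z) = s z := by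
      split_ifs with h
      · rw [h, hs0]
      · rw [hfz z, hsv, mul_div_mul_left _ _ h]
    rw [h2] at h1
    have h3 : Complex.exp (-(lam : ℂ) * Complex.I) *
        (1 + z * deriv (deriv f) z / deriv f z + (q : ℂ) * s z) =
        ((1 + q : ℝ) : ℂ) * (Complex.exp (-(lam : ℂ) * Complex.I) * P z) := by
      rw [hPv]
      field_simp
    rw [h3, Complex.re_ofReal_mul] at h1
    exact pos_of_mul_pos_right h1 (by positivity)
  have hnc : (1 + q) * Real.cos lam < 1 := by
    rw [lt_div_iff₀ (by positivity)] at hcos2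
    nlinarith
  have D : AuxDat (1 + q) (-((1 + q) * Real.cos lam : ℝ) * Complex.exp ((lam : ℂ) * Complex.I))
      f (deriv f) s (deriv s) P :=
    { hn := by linarith
      hc := by
        rw [norm_mul, Complex.norm_exp_ofReal_mul_I, norm_neg, Complex.norm_real, mul_one,
          Real.norm_of_nonneg (by positivity)]
        exact hnc
      hf := dAt hf
      hs := dAt hsd
      cf1 := hd1.continuousOn
      cs1 := (hsd.deriv ho).continuousOn
      cP := hPd.continuousOn
      f0 := hf0
      fne := hfne
      f10 := hf'0
      f1ne := hf'
      s0 := hs0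
      P0 := hP0
      sne := fun z hz => by rw [hsv]; exact div_ne_zero (hf' z hz) (hgne z hz)
      e1 := fun z hz => by
        have := hgne z hz
        rw [hsv, hfz z]; field_simp
      e2 := fun z hz => by
        have h1 := hgne z hz
        have h2 := hf' z hz
        have h3 := hg' z hz
        rw [hs1 z hz, hPv, hsv]
        have h4 : (1 + (q : ℂ)) ≠ 0 := by simpa using hn0
        push_cast
        field_simp
        linear_combination (-deriv f z) * h3
      mu := fun τ hτ z hz hzτ =>
        final_mu lam (1 + q) τ z P hcos (by linarith) hnc hPd hP0 hP1 hre hτ hz hzτ }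
  exact D.inj


/-- If `q > 0`, `0 < cos λ < 1/(1 + 2q)`, `f''(0) = 0` and `Re(e^{−iλ}(1 + zf''/f' + q·zf'/f)) > 0` on 𝔻, then `f` is univalent. -/
theorem univalence_q_pos_second_deriv_zero (lam : ℝ)
    (hlam : lam ∈ Set.Ioo (-(Real.pi / 2)) (Real.pi / 2))
    (q : ℝ) (hq : 0 < q)
    (hcos : 0 < Real.cos lam) (hcos2 : Real.cos lam < 1 / (1 + 2 * q))
    (f : ℂ → ℂ)
    (hf : DifferentiableOn ℂ f (ball (0 : ℂ) 1))
    (hf0 : f 0 = 0) (hf'0 : deriv f 0 = 1)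
    (hf''0 : deriv (deriv f) 0 = 0)
    (hf' : ∀ z ∈ ball (0 : ℂ) 1, deriv f z ≠ 0)
    (hfne : ∀ z ∈ ball (0 : ℂ) 1, z ≠ 0 → f z ≠ 0)
    (hcond : ∀ z ∈ ball (0 : ℂ) 1,
      0 < (Complex.exp (-(lam : ℂ) * Complex.I) *
        (1 + z * deriv (deriv f) z / deriv f z +
          (q : ℂ) * (if z = 0 then 1 else z * deriv f z / f z))).re) :
    Set.InjOn f (ball (0 : ℂ) 1) := by
  exact final_dat lam q hq hcos hcos2 f hf hf0 hf'0 hf''0 hf' hfne hcond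
end

section
/- Let λ ∈ (−π/2, π/2) with 0 < cos λ ≤ 1/2, and let f be a λ-Robertson function. Then f is univalent (injective) on the unit disk 𝔻. -/
open Metric

/-- The Loewner-type chain. -/
noncomputable def chainF (d : ℂ) (f h : ℂ → ℂ) (p : ℂ × ℂ) : ℂ :=
  d * f p.2 + (p.1 - 1) * h p.2

lemma chainF_strict (d : ℂ) (f h : ℂ → ℂ) (s a f1 h1 : ℂ)
    (hf : HasStrictDerivAt f f1 a) (hh : HasStrictDerivAt h h1 a) :
    HasStrictFDerivAt (chainF d f h)
      ((h a) • ContinuousLinearMap.fst ℂ ℂ ℂ +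
        (d * f1 + (s - 1) * h1) • ContinuousLinearMap.snd ℂ ℂ ℂ) (s, a) := by
  have h2 : HasStrictFDerivAt (Prod.snd : ℂ × ℂ → ℂ) (ContinuousLinearMap.snd ℂ ℂ ℂ) (s, a) :=
    hasStrictFDerivAt_snd
  have h1' : HasStrictFDerivAt (Prod.fst : ℂ × ℂ → ℂ) (ContinuousLinearMap.fst ℂ ℂ ℂ) (s, a) :=
    hasStrictFDerivAt_fst
  have hf2 := HasStrictDerivAt.comp_hasStrictFDerivAt (s, a) (h₂ := f) hf h2
  have hh2 := HasStrictDerivAt.comp_hasStrictFDerivAt (s, a) (h₂ := h) hh h2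
  have := (hf2.const_mul d).add ((h1'.sub_const 1).mul hh2)
  refine this.congr_fderiv ?_
  ext <;> simp [Function.comp]

lemma chainF_locinj (d : ℂ) (f h : ℂ → ℂ) (s a f1 h1 : ℂ)
    (hf : HasStrictDerivAt f f1 a) (hh : HasStrictDerivAt h h1 a)
    (hD : d * f1 + (s - 1) * h1 ≠ 0) (t x y : ℕ → ℂ)
    (ht : Filter.Tendsto t Filter.atTop (nhds s))
    (hx : Filter.Tendsto x Filter.atTop (nhds a))
    (hy : Filter.Tendsto y Filter.atTop (nhds a))
    (hxy : ∀ n, x n ≠ y n) (he : ∀ n, chainF d f h (t n, x n) = chainF d f h (t n, y n)) :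
    False := by
  have hs := chainF_strict d f h s a f1 h1 hf hh
  have hlo := hs.isLittleO
  have hpos : 0 < ‖d * f1 + (s - 1) * h1‖ / 2 := by positivity
  have hb := hlo.def hpos
  have htend : Filter.Tendsto (fun n => ((t n, x n), (t n, y n))) Filter.atTop
      (nhds ((s, a), (s, a))) :=
    (ht.prodMk_nhds hx).prodMk_nhds (ht.prodMk_nhds hy)
  obtain ⟨n, hn⟩ := (htend.eventually hb).exists
  have hne : 0 < ‖x n - y n‖ := norm_pos_iff.mpr (sub_ne_zero.mpr (hxy n))
  simp only [he, sub_self, Prod.mk_sub_mk, zero_sub, norm_neg] at hn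
  have e1 : ‖((0 : ℂ), x n - y n)‖ = ‖x n - y n‖ := by simp [Prod.norm_def]
  rw [e1] at hn
  simp at hn
  nlinarith

lemma chainF_implicit (d : ℂ) (f h : ℂ → ℂ) (s a f1 h1 : ℂ)
    (hf : HasStrictDerivAt f f1 a) (hh : HasStrictDerivAt h h1 a)
    (hD : d * f1 + (s - 1) * h1 ≠ 0) :
    ∃ ψ : ℂ → ℂ, ψ s = a ∧ HasDerivAt ψ (-(h a / (d * f1 + (s - 1) * h1))) s ∧
      ∀ᶠ t in nhds s, chainF d f h (t, ψ t) = chainF d f h (s, a) := by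
  have hs := chainF_strict d f h s a f1 h1 hf hh
  set D := d * f1 + (s - 1) * h1 with hDdef
  set L : ℂ × ℂ →L[ℂ] ℂ := (h a) • ContinuousLinearMap.fst ℂ ℂ ℂ +
        D • ContinuousLinearMap.snd ℂ ℂ ℂ with hL
  have hinv : (L ∘L .inr ℂ ℂ ℂ).IsInvertible := by
    refine ⟨ContinuousLinearEquiv.smulLeft (Units.mk0 D hD), ?_⟩
    ext
    simp [hL, Units.smul_def]
  have hev := hs.eventually_apply_implicitFunctionOfProdDomain hinv
  have hiff := (hs.eventually_apply_eq_iff_implicitFunctionOfProdDomain hinv).self_of_nhds.mp rfl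
  have hder := hs.hasStrictFDerivAt_implicitFunctionOfProdDomain hinv
  refine ⟨hs.implicitFunctionOfProdDomain hinv, hiff, ?_, hev⟩
  have := hder.hasFDerivAt.hasDerivAt
  refine this.congr_deriv ?_
  symm
  have hz : (L ∘L .inr ℂ ℂ ℂ) ((h a) / D) = h a := by
    simp [hL]; field_simp
  have hz2 : (L ∘L .inl ℂ ℂ ℂ) 1 = h a := by simp [hL]
  have : (L ∘L .inr ℂ ℂ ℂ).inverse (h a) = h a / D := by
    obtain ⟨e, he⟩ := hinv
    rw [← he] at hz ⊢
    rw [ContinuousLinearMap.inverse_equiv]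
    conv_lhs => rw [← hz]
    simp
  change -(h a / D) = -((L ∘L .inr ℂ ℂ ℂ).inverse ((L ∘L .inl ℂ ℂ ℂ) 1))
  rw [hz2, this]

/-- points stay in the region `s |z|^2 ≤ r^2` -/
lemma stay (ψ : ℂ → ℂ) (s r : ℝ) (a E : ℂ) (hr : 0 < r) (hψ : ψ s = a)
    (hd : HasDerivAt ψ (-(a / E)) (s : ℂ)) (ha : s * ‖a‖ ^ 2 ≤ r ^ 2)
    (hE : s * ‖a‖ ^ 2 < r ^ 2 ∨ ‖E - s‖ < s) :
    ∀ᶠ t : ℝ in nhdsWithin s (Set.Ioi s), t * ‖ψ t‖ ^ 2 ≤ r ^ 2 := by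
  have hdr : HasDerivAt (fun t : ℝ => ψ t) (-(a / E)) s := hd.comp_ofReal
  have hcont : ContinuousAt (fun t : ℝ => t * ‖ψ t‖ ^ 2) s :=
    continuousAt_id.mul (hdr.continuousAt.norm.pow 2)
  rcases ha.lt_or_eq with h | h
  · have : ∀ᶠ t : ℝ in nhds s, t * ‖ψ t‖ ^ 2 < r ^ 2 :=
      hcont.eventually_lt_const (by simpa [hψ] using h)
    exact (this.filter_mono nhdsWithin_le_nhds).mono fun t ht => ht.le
  · have hE' : ‖E - s‖ < s := by
      rcases hE with h' | h'
      · linarith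
      · exact h'
    have hsq : HasDerivAt (fun t : ℝ => ‖ψ t‖ ^ 2) (2 * inner ℝ (ψ s) (-(a / E))) s := hdr.norm_sq
    have hφ := (hasDerivAt_id s).mul hsq
    have hneg : 1 * ‖ψ s‖ ^ 2 + s * (2 * inner ℝ (ψ s) (-(a / E))) < 0 := by
      rw [hψ]
      have hE0 : 0 < Complex.normSq E ∧ Complex.normSq E < 2 * s * E.re := by
        have h2 : ‖E - s‖ ^ 2 < s ^ 2 := by gcongr
        rw [← Complex.normSq_eq_norm_sq, Complex.normSq_apply] at h2
        simp at h2
        have h3 : Complex.normSq E < 2 * s * E.re := by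
          rw [Complex.normSq_apply]; nlinarith
        refine ⟨Complex.normSq_pos.mpr ?_, h3⟩
        rintro rfl
        simp at h3
      have ha0 : 0 < ‖a‖ ^ 2 := by
        by_contra hc
        have : ‖a‖ ^ 2 = 0 := le_antisymm (not_lt.mp hc) (by positivity)
        rw [this] at h
        have : 0 < r ^ 2 := by positivity
        linarith
      have hin : inner ℝ a (-(a / E)) = -(‖a‖ ^ 2 * (E.re / Complex.normSq E)) := by
        rw [Complex.inner, ← Complex.normSq_eq_norm_sq, Complex.normSq_apply]
        simp [Complex.div_re, Complex.div_im]
        ring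
      rw [hin]
      have : 1 < 2 * s * (E.re / Complex.normSq E) := by
        rw [← mul_div_assoc, lt_div_iff₀ hE0.1]; linarith [hE0.2]
      nlinarith
    have hsl := (hasDerivAt_iff_tendsto_slope.mp hφ).eventually_lt_const (u := 0) (by simpa using hneg)
    have hsl2 := hsl.filter_mono (nhdsWithin_mono s (fun t (ht : s < t) => ht.ne' : Set.Ioi s ⊆ {s}ᶜ))
    filter_upwards [hsl2, self_mem_nhdsWithin] with t ht hts
    have hts' : 0 < t - s := sub_pos.mpr hts
    rw [slope_def_field, div_lt_iff₀ hts'] at ht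
    simp [hψ] at ht
    linarith

lemma large_inj (d : ℂ) (f h : ℂ → ℂ) (f1 : ℂ)
    (hf : HasStrictDerivAt f f1 0) (hh : HasStrictDerivAt h 1 0) (r : ℝ) :
    ∃ M : ℝ, ∀ s : ℝ, M < s → 1 ≤ s → ∀ a b : ℂ, s * ‖a‖ ^ 2 ≤ r ^ 2 → s * ‖b‖ ^ 2 ≤ r ^ 2 →
      chainF d f h (s, a) = chainF d f h (s, b) → a = b := by
  have h1 := hh.hasStrictFDerivAt.isLittleO.def (c := 1 / 4) (by norm_num)
  have hg : HasStrictDerivAt (fun z => d * f z - h z) (d * f1 - 1) 0 :=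
    (hf.const_mul d).sub hh
  have h2 := hg.hasStrictFDerivAt.isLittleO.def (c := 1) (by norm_num)
  have h3 := h1.and h2
  rw [nhds_prod_eq, Filter.Eventually, Filter.mem_prod_same_iff] at h3
  obtain ⟨t, ht, hts⟩ := h3
  obtain ⟨ε, hε, hball⟩ := Metric.mem_nhds_iff.mp ht
  set C := ‖d * f1 - 1‖ with hC
  refine ⟨max (r ^ 2 / ε ^ 2) (4 * (C + 1)), fun s hs hs1 a b ha hb hab => ?_⟩
  have hsa : r ^ 2 / ε ^ 2 < s := lt_of_le_of_lt (le_max_left _ _) hs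
  have hsb : 4 * (C + 1) < s := lt_of_le_of_lt (le_max_right _ _) hs
  have key : ∀ x : ℂ, s * ‖x‖ ^ 2 ≤ r ^ 2 → x ∈ t := by
    intro x hx
    apply hball
    rw [mem_ball_zero_iff]
    rw [div_lt_iff₀ (by positivity)] at hsa
    have : s * ‖x‖ ^ 2 < s * ε ^ 2 := lt_of_le_of_lt hx hsa
    have : ‖x‖ ^ 2 < ε ^ 2 := lt_of_mul_lt_mul_left this (by linarith)
    exact lt_of_pow_lt_pow_left₀ 2 hε.le this
  obtain ⟨hA, hB⟩ := hts (Set.mk_mem_prod (key a ha) (key b hb))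
  simp at hA hB
  by_contra hne
  have hpos : 0 < ‖a - b‖ := norm_pos_iff.mpr (sub_ne_zero.mpr hne)
  simp only [chainF] at hab
  have e : (s : ℂ) * (a - b) = -(s * (h a - h b - (a - b)))
      - ((d * f a - h a - (d * f b - h b)) - (a - b) * (d * f1 - 1)) - (a - b) * (d * f1 - 1) := by
    linear_combination hab
  have hn : ‖(s : ℂ) * (a - b)‖ ≤ s * (1 / 4 * ‖a - b‖) + 1 * ‖a - b‖ + ‖a - b‖ * C := by
    rw [e]
    refine (norm_sub_le _ _).trans (add_le_add ((norm_sub_le _ _).trans (add_le_add ?_ ?_)) ?_)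
    · rw [norm_neg, norm_mul, Complex.norm_real, Real.norm_of_nonneg (by linarith)]
      have := hA
      norm_num at this ⊢
      gcongr
    · simpa using hB
    · rw [norm_mul]
  rw [norm_mul, Complex.norm_real, Real.norm_of_nonneg (by linarith)] at hn
  have hC0 : 0 ≤ C := norm_nonneg _
  nlinarith

lemma core (d : ℂ) (hd : d ≠ 0) (f h f1 h1 w : ℂ → ℂ)
    (hf : ∀ z ∈ ball (0 : ℂ) 1, HasStrictDerivAt f (f1 z) z)
    (hh : ∀ z ∈ ball (0 : ℂ) 1, HasStrictDerivAt h (h1 z) z)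
    (hf1 : ∀ z ∈ ball (0 : ℂ) 1, f1 z ≠ 0)
    (hhz : ∀ z ∈ ball (0 : ℂ) 1, h z = z * f1 z)
    (hw : ∀ z ∈ ball (0 : ℂ) 1, h1 z = f1 z * w z)
    (h10 : h1 0 = 1)
    (key : ∀ z ∈ ball (0 : ℂ) 1, ∀ s : ℝ, 1 < s → s * ‖z‖ ^ 2 ≤ 1 →
      ‖d + (s - 1) * w z - s‖ < s) :
    Set.InjOn f (ball (0 : ℂ) 1) := by
  intro z₁ hz₁ z₂ hz₂ heq
  by_contra hne
  rw [mem_ball_zero_iff] at hz₁ hz₂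
  obtain ⟨r, hr1, hr2⟩ := exists_between (max_lt hz₁ hz₂)
  have hz₁r : ‖z₁‖ < r := (le_max_left _ _).trans_lt hr1
  have hz₂r : ‖z₂‖ < r := (le_max_right _ _).trans_lt hr1
  have hr0 : 0 < r := (norm_nonneg _).trans_lt hz₁r
  have hr21 : r ^ 2 ≤ 1 := by nlinarith
  have hrad : ∀ (s : ℝ) (z : ℂ), 1 ≤ s → s * ‖z‖ ^ 2 ≤ r ^ 2 → ‖z‖ ≤ r := by
    intro s z hs hz
    have : ‖z‖ ^ 2 ≤ r ^ 2 := by nlinarith [sq_nonneg ‖z‖]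
    exact le_of_sq_le_sq this hr0.le
  have hin : ∀ (s : ℝ) (z : ℂ), 1 ≤ s → s * ‖z‖ ^ 2 ≤ r ^ 2 → z ∈ ball (0 : ℂ) 1 := by
    intro s z hs hz
    rw [mem_ball_zero_iff]
    exact (hrad s z hs hz).trans_lt hr2
  have hDeq : ∀ (s : ℝ) (z : ℂ), z ∈ ball (0 : ℂ) 1 →
      d * f1 z + ((s : ℂ) - 1) * h1 z = f1 z * (d + (s - 1) * w z) := by
    intro s z hz; rw [hw z hz]; ring
  have hE0 : ∀ (s : ℝ) (z : ℂ), 1 ≤ s → s * ‖z‖ ^ 2 ≤ r ^ 2 → d + ((s : ℂ) - 1) * w z ≠ 0 := by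
    intro s z hs hz h0
    rcases hs.eq_or_lt with h | h
    · rw [← h] at h0; simp at h0; exact hd h0
    · have := key z (hin s z hs hz) s h (hz.trans hr21)
      rw [h0] at this
      simp [abs_of_pos (by linarith : 0 < s)] at this
  have hD0 : ∀ (s : ℝ) (z : ℂ), 1 ≤ s → s * ‖z‖ ^ 2 ≤ r ^ 2 →
      d * f1 z + ((s : ℂ) - 1) * h1 z ≠ 0 := by
    intro s z hs hz
    rw [hDeq s z (hin s z hs hz)]
    exact mul_ne_zero (hf1 z (hin s z hs hz)) (hE0 s z hs hz)
  set S : Set ℝ := {s | 1 ≤ s ∧ ∃ a b : ℂ, a ≠ b ∧ s * ‖a‖ ^ 2 ≤ r ^ 2 ∧ s * ‖b‖ ^ 2 ≤ r ^ 2 ∧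
    chainF d f h (s, a) = chainF d f h (s, b)} with hS
  have hz₁2 : 1 * ‖z₁‖ ^ 2 < r ^ 2 := by rw [one_mul]; gcongr
  have hz₂2 : 1 * ‖z₂‖ ^ 2 < r ^ 2 := by rw [one_mul]; gcongr
  have hF1 : chainF d f h ((1 : ℝ), z₁) = chainF d f h ((1 : ℝ), z₂) := by simp [chainF, heq]
  have h1S : (1 : ℝ) ∈ S := ⟨le_rfl, z₁, z₂, hne, hz₁2.le, hz₂2.le, hF1⟩
  have h0 : (0 : ℂ) ∈ ball (0 : ℂ) 1 := by simp
  obtain ⟨M, hM⟩ := large_inj d f h (f1 0) (hf 0 h0) (h10 ▸ hh 0 h0) r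
  have hbdd : BddAbove S := by
    refine ⟨M, fun s hs => ?_⟩
    obtain ⟨hs1, a, b, hab, ha, hb, he⟩ := hs
    by_contra hc
    exact hab (hM s (not_le.mp hc) hs1 a b ha hb he)
  -- maximum
  have hmax : sSup S ∈ S := by
    obtain ⟨u, -, hu, huS⟩ := exists_seq_tendsto_sSup ⟨1, h1S⟩ hbdd
    choose hu1 a b hab ha hb he using huS
    have hcomp : IsCompact (closedBall (0 : ℂ) r ×ˢ closedBall (0 : ℂ) r) :=
      (isCompact_closedBall _ _).prod (isCompact_closedBall _ _)
    obtain ⟨⟨a', b'⟩, -, φ, hφ, hlim⟩ := hcomp.tendsto_subseq (x := fun n => (a n, b n))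
      (fun n => ⟨by simpa using hrad _ _ (hu1 n) (ha n), by simpa using hrad _ _ (hu1 n) (hb n)⟩)
    have hla : Filter.Tendsto (fun n => a (φ n)) Filter.atTop (nhds a') :=
      (continuous_fst.tendsto _).comp hlim
    have hlb : Filter.Tendsto (fun n => b (φ n)) Filter.atTop (nhds b') :=
      (continuous_snd.tendsto _).comp hlim
    have hlu : Filter.Tendsto (fun n => u (φ n)) Filter.atTop (nhds (sSup S)) :=
      hu.comp hφ.tendsto_atTop
    have hluc : Filter.Tendsto (fun n => (u (φ n) : ℂ)) Filter.atTop (nhds ((sSup S : ℝ) : ℂ)) :=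
      (Complex.continuous_ofReal.tendsto _).comp hlu
    have hs1 : 1 ≤ sSup S := le_csSup hbdd h1S
    have ha' : sSup S * ‖a'‖ ^ 2 ≤ r ^ 2 :=
      le_of_tendsto' (hlu.mul (hla.norm.pow 2)) (fun n => ha _)
    have hb' : sSup S * ‖b'‖ ^ 2 ≤ r ^ 2 :=
      le_of_tendsto' (hlu.mul (hlb.norm.pow 2)) (fun n => hb _)
    have hca := (chainF_strict d f h (sSup S : ℝ) a' _ _ (hf a' (hin _ _ hs1 ha'))
      (hh a' (hin _ _ hs1 ha'))).continuousAt
    have hcb := (chainF_strict d f h (sSup S : ℝ) b' _ _ (hf b' (hin _ _ hs1 hb'))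
      (hh b' (hin _ _ hs1 hb'))).continuousAt
    have l1 := hca.tendsto.comp (hluc.prodMk_nhds hla)
    have l2 := hcb.tendsto.comp (hluc.prodMk_nhds hlb)
    have hee : chainF d f h ((sSup S : ℝ), a') = chainF d f h ((sSup S : ℝ), b') :=
      tendsto_nhds_unique (l1.congr fun n => he (φ n)) l2
    refine ⟨hs1, a', b', ?_, ha', hb', hee⟩
    rintro rfl
    exact chainF_locinj d f h (sSup S : ℝ) a' _ _ (hf a' (hin _ _ hs1 ha'))
      (hh a' (hin _ _ hs1 ha')) (hD0 _ _ hs1 ha') _ _ _ hluc hla hlb (fun n => hab _)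
      (fun n => he _)
  -- push
  have push : ∃ (a b : ℂ), a ≠ b ∧ sSup S * ‖a‖ ^ 2 ≤ r ^ 2 ∧ sSup S * ‖b‖ ^ 2 ≤ r ^ 2 ∧
      chainF d f h ((sSup S : ℝ), a) = chainF d f h ((sSup S : ℝ), b) ∧
      (sSup S * ‖a‖ ^ 2 < r ^ 2 ∨ ‖d + (((sSup S : ℝ) : ℂ) - 1) * w a - (sSup S : ℝ)‖ < sSup S) ∧
      (sSup S * ‖b‖ ^ 2 < r ^ 2 ∨ ‖d + (((sSup S : ℝ) : ℂ) - 1) * w b - (sSup S : ℝ)‖ < sSup S) := by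
    rcases hmax.1.eq_or_lt with h | h
    · rw [← h]
      exact ⟨z₁, z₂, hne, hz₁2.le, hz₂2.le, hF1, Or.inl hz₁2, Or.inl hz₂2⟩
    · obtain ⟨hs1, a, b, hab, ha, hb, he⟩ := hmax
      exact ⟨a, b, hab, ha, hb, he, Or.inr (key a (hin _ _ hs1 ha) _ h (ha.trans hr21)),
        Or.inr (key b (hin _ _ hs1 hb) _ h (hb.trans hr21))⟩
  obtain ⟨a, b, hab, ha, hb, he, hca, hcb⟩ := push
  have hs1 := hmax.1
  set s := sSup S with hs
  have mk : ∀ a : ℂ, s * ‖a‖ ^ 2 ≤ r ^ 2 →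
      (s * ‖a‖ ^ 2 < r ^ 2 ∨ ‖d + ((s : ℂ) - 1) * w a - s‖ < s) →
      ∃ ψ : ℝ → ℂ, Filter.Tendsto ψ (nhdsWithin s (Set.Ioi s)) (nhds a) ∧
        (∀ᶠ t : ℝ in nhdsWithin s (Set.Ioi s), t * ‖ψ t‖ ^ 2 ≤ r ^ 2) ∧
        (∀ᶠ t : ℝ in nhdsWithin s (Set.Ioi s), chainF d f h (t, ψ t) = chainF d f h (s, a)) := by
    intro a ha hca
    have hain := hin s a hs1 ha
    obtain ⟨ψ, hψ, hder, hev⟩ := chainF_implicit d f h s a _ _ (hf a hain) (hh a hain)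
      (hD0 s a hs1 ha)
    rw [hDeq s a hain, hhz a hain, mul_comm a, mul_div_mul_left _ _ (hf1 a hain)] at hder
    have hof : Filter.Tendsto (fun t : ℝ => (t : ℂ)) (nhdsWithin s (Set.Ioi s)) (nhds (s : ℂ)) :=
      (Complex.continuous_ofReal.tendsto s).mono_left nhdsWithin_le_nhds
    refine ⟨fun t => ψ t, ?_, stay ψ s r a _ hr0 hψ hder ha hca, hof.eventually hev⟩
    have := hder.continuousAt.tendsto.comp hof
    rwa [hψ] at this
  obtain ⟨ψ, p1, p2, p3⟩ := mk a ha hca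
  obtain ⟨χ, q1, q2, q3⟩ := mk b hb hcb
  have hne' : ∀ᶠ t : ℝ in nhdsWithin s (Set.Ioi s), ψ t ≠ χ t := 
    (p1.prodMk_nhds q1).eventually ((isOpen_ne_fun continuous_fst continuous_snd).mem_nhds hab)
  obtain ⟨t, ht1, ht2, ht3, ht4, ht5, ht6⟩ :=
    (p2.and (p3.and (q2.and (q3.and (hne'.and self_mem_nhdsWithin))))).exists
  have hts : s < t := ht6
  have : t ∈ S := ⟨hs1.trans hts.le, ψ t, χ t, ht5, ht1, ht3, by rw [ht2, ht4, he]⟩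
  exact absurd (le_csSup hbdd this) (not_le.mpr hts)

/-- Pure inequality part. -/
lemma key_ineq (s : ℝ) (hs : 1 < s) (P : ℂ) (hP : s * ‖P - 1‖ ^ 2 ≤ ‖P + 1‖ ^ 2) :
    ‖((s : ℂ) - 1) * P - (s + 1)‖ < 2 * s := by
  have : ‖((s : ℂ) - 1) * P - (s + 1)‖ ^ 2 < (2 * s) ^ 2 := by
    rw [← Complex.normSq_eq_norm_sq, Complex.normSq_apply] at hP ⊢
    rw [← Complex.normSq_eq_norm_sq, Complex.normSq_apply] at hP
    simp at hP ⊢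
    have h2 := mul_le_mul_of_nonneg_left hP (sub_pos.mpr hs).le
    nlinarith
  exact lt_of_pow_lt_pow_left₀ 2 (by linarith) this

lemma schwarz_P (P : ℂ → ℂ) (hP : DifferentiableOn ℂ P (ball (0 : ℂ) 1)) (h0 : P 0 = 1)
    (hre : ∀ z ∈ ball (0 : ℂ) 1, 0 < (P z).re) (z : ℂ) (hz : z ∈ ball (0 : ℂ) 1) :
    ‖P z - 1‖ ≤ ‖z‖ * ‖P z + 1‖ := by
  have hne : ∀ z ∈ ball (0 : ℂ) 1, P z + 1 ≠ 0 := by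
    intro z hz h
    have := congrArg Complex.re h
    simp at this
    linarith [hre z hz]
  have hd : DifferentiableOn ℂ (fun z => (P z - 1) / (P z + 1)) (ball (0 : ℂ) 1) :=
    (hP.sub_const 1).div (hP.add_const 1) hne
  have := Complex.norm_le_norm_of_mapsTo_ball hd ?_ (by simp [h0]) (mem_ball_zero_iff.mp hz)
  · simp only [norm_div] at this
    rwa [div_le_iff₀ (norm_pos_iff.mpr (hne z hz))] at this
  · intro z hz
    rw [mem_closedBall_zero_iff, norm_div, div_le_one (norm_pos_iff.mpr (hne z hz))]
    apply le_of_sq_le_sq _ (norm_nonneg _)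
    rw [← Complex.normSq_eq_norm_sq, ← Complex.normSq_eq_norm_sq, Complex.normSq_apply,
      Complex.normSq_apply]
    simp
    nlinarith [hre z hz]

/-- A λ-Robertson function with `0 < cos λ ≤ 1/2` is univalent on 𝔻. -/
theorem robertson_univalent (lam : ℝ)
    (hlam : lam ∈ Set.Ioo (-(Real.pi / 2)) (Real.pi / 2))
    (hcos : 0 < Real.cos lam) (hcos2 : Real.cos lam ≤ 1 / 2)
    (f : ℂ → ℂ)
    (hf : DifferentiableOn ℂ f (ball (0 : ℂ) 1))
    (hf0 : f 0 = 0) (hf'0 : deriv f 0 = 1)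
    (hf' : ∀ z ∈ ball (0 : ℂ) 1, deriv f z ≠ 0)
    (hRob : ∀ z ∈ ball (0 : ℂ) 1,
      0 < (Complex.exp (-(lam : ℂ) * Complex.I) *
        (1 + z * deriv (deriv f) z / deriv f z)).re) :
    Set.InjOn f (ball (0 : ℂ) 1) := by
  have hopen : IsOpen (ball (0 : ℂ) 1) := isOpen_ball
  have hdf : DifferentiableOn ℂ (deriv f) (ball (0 : ℂ) 1) := hf.deriv hopen
  have hddf : DifferentiableOn ℂ (deriv (deriv f)) (ball (0 : ℂ) 1) := hdf.deriv hopen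
  have h0 : (0 : ℂ) ∈ ball (0 : ℂ) 1 := by simp
  set c : ℝ := Real.cos lam with hc
  set σ : ℝ := Real.sin lam with hσ
  have hcs : σ ^ 2 + c ^ 2 = 1 := Real.sin_sq_add_cos_sq lam
  have hcsC : (σ : ℂ) ^ 2 + (c : ℂ) ^ 2 = 1 := by exact_mod_cast hcs
  have hI : Complex.I ^ 2 = -1 := Complex.I_sq
  have hc0 : (c : ℂ) ≠ 0 := by exact_mod_cast hcos.ne'
  have hexp : Complex.exp (-(lam : ℂ) * Complex.I) = c - σ * Complex.I := by
    rw [Complex.exp_mul_I, Complex.cos_neg, Complex.sin_neg, ← Complex.ofReal_cos,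
      ← Complex.ofReal_sin]
    ring
  rw [hexp] at hRob
  set w : ℂ → ℂ := fun z => 1 + z * deriv (deriv f) z / deriv f z with hw
  set P : ℂ → ℂ := fun z => ((c - σ * Complex.I) * w z + σ * Complex.I) / c with hP
  have hPd : DifferentiableOn ℂ P (ball (0 : ℂ) 1) := by
    have hwd : DifferentiableOn ℂ w (ball (0 : ℂ) 1) :=
      ((differentiableOn_id.mul hddf).div hdf hf').const_add 1
    exact ((hwd.const_mul _).add_const _).div_const _
  have hP0 : P 0 = 1 := by simp [hP, hw, hc0]
  have hPre : ∀ z ∈ ball (0 : ℂ) 1, 0 < (P z).re := by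
    intro z hz
    have h1 := hRob z hz
    have : (P z).re = ((c - σ * Complex.I) * w z).re / c := by
      simp only [hP]
      rw [Complex.div_ofReal_re, Complex.add_re]
      simp
    rw [this]
    exact div_pos h1 hcos
  have hsch := schwarz_P P hPd hP0 hPre
  have hwP : ∀ z, w z = 1 + (c + σ * Complex.I) * c * (P z - 1) := by
    intro z
    have : (c : ℂ) * P z = (c - σ * Complex.I) * w z + σ * Complex.I := by
      simp only [hP]; field_simp
    linear_combination (-(c + σ * Complex.I)) * this - (w z - 1) * hcsC
      + (-(σ : ℂ)^2 * (1 - w z)) * hI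
  have hnorm : ‖(c + σ * Complex.I : ℂ)‖ = 1 := by
    rw [← sq_eq_sq₀ (norm_nonneg _) zero_le_one, ← Complex.normSq_eq_norm_sq,
      Complex.normSq_add_mul_I]
    linarith
  refine core (1 - 2 * ((c + σ * Complex.I) * c)) ?_ f (fun z => z * deriv f z) (deriv f)
    (fun z => deriv f z + z * deriv (deriv f) z) w ?_ ?_ hf' (fun _ _ => rfl) ?_ (by simp [hf'0]) ?_
  · intro h
    have h2 : (c + σ * Complex.I) ^ 2 = 0 := by
      linear_combination (σ : ℂ) ^ 2 * hI - hcsC - h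
    have := pow_eq_zero_iff (two_ne_zero) |>.mp h2
    rw [this] at hnorm
    simp at hnorm
  · intro z hz
    exact ((hf.analyticAt (hopen.mem_nhds hz)).hasStrictDerivAt)
  · intro z hz
    have := (hasStrictDerivAt_id z).mul ((hdf.analyticAt (hopen.mem_nhds hz)).hasStrictDerivAt)
    simpa using! this
  · intro z hz
    have := hf' z hz
    simp only [hw]
    field_simp
  · intro z hz s hs hsz
    have h1 := hsch z hz
    have h2 : s * ‖P z - 1‖ ^ 2 ≤ ‖P z + 1‖ ^ 2 := by
      calc s * ‖P z - 1‖ ^ 2 ≤ s * (‖z‖ * ‖P z + 1‖) ^ 2 := by gcongr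
        _ = (s * ‖z‖ ^ 2) * ‖P z + 1‖ ^ 2 := by ring
        _ ≤ 1 * ‖P z + 1‖ ^ 2 := by gcongr
        _ = _ := one_mul _
    have h3 := key_ineq s hs (P z) h2
    have e : 1 - 2 * ((c + σ * Complex.I) * c) + ((s : ℂ) - 1) * w z - s =
        (c + σ * Complex.I) * c * (((s : ℂ) - 1) * P z - (s + 1)) := by
      rw [hwP]; ring
    rw [e, norm_mul, norm_mul, hnorm, one_mul, Complex.norm_real, Real.norm_of_nonneg hcos.le]
    have := norm_nonneg (((s : ℂ) - 1) * P z - (s + 1))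
    nlinarith
end

section
/- Let λ ∈ (−π/2, π/2) and let f be a λ-Robertson function with f''(0) = 0. Then f is univalent (injective) on the unit disk 𝔻. -/
open Metric
open Filter Topology

lemma rob_implicit {H : ℂ × ℂ → ℂ} {L : ℂ × ℂ →L[ℂ] ℂ} {s x : ℂ}
    (h : HasStrictFDerivAt H L (s, x)) (hB : L (0, 1) ≠ 0) :
    ∃ ψ : ℂ → ℂ, ψ s = x ∧ HasDerivAt ψ (- L (1, 0) / L (0, 1)) s ∧
      ∀ᶠ t in 𝓝 s, H (t, ψ t) = H (s, x) := by
  have hinv : (L ∘L .inr ℂ ℂ ℂ).IsInvertible := by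
    refine ⟨ContinuousLinearEquiv.unitsEquivAut ℂ (Units.mk0 _ hB), ?_⟩
    ext
    simp
  have h1 := h.tendsto_implicitFunctionOfProdDomain hinv
  have h2 := h.eventually_apply_implicitFunctionOfProdDomain hinv
  have h3 := h.hasStrictFDerivAt_implicitFunctionOfProdDomain hinv
  have h4 := (h.eventually_apply_eq_iff_implicitFunctionOfProdDomain hinv).self_of_nhds.mp rfl
  set ψ := h.implicitFunctionOfProdDomain hinv
  simp only at h4 h3 h2
  refine ⟨ψ, h4, ?_, h2⟩
  have h5 : HasDerivAt ψ _ s := h3.hasFDerivAt.hasDerivAt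
  have h6 : HasStrictFDerivAt H L (s, ψ s) := by rw [h4]; exact h
  have h7 := h6.hasFDerivAt.comp_hasDerivAt s ((hasDerivAt_id s).prodMk h5)
  have h8 : HasDerivAt (fun t => H (t, ψ t)) 0 s :=
    (hasDerivAt_const s (H (s, x))).congr_of_eventuallyEq h2
  have h9 := h7.unique h8
  set d := (-(L ∘L .inr ℂ ℂ ℂ).inverse ∘L (L ∘L .inl ℂ ℂ ℂ)) 1
  have h10 : L (1, d) = L (1, 0) + d * L (0, 1) := by
    have : ((1, d) : ℂ × ℂ) = (1, 0) + d • (0, 1) := by simp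
    rw [this, map_add, map_smul, smul_eq_mul]
  have h11 : d = - L (1, 0) / L (0, 1) := by
    rw [h10] at h9
    field_simp
    linear_combination h9
  rw [← h11]
  exact h5

lemma rob_localinj {H : ℂ × ℂ → ℂ} {L : ℂ × ℂ →L[ℂ] ℂ} {u : ℂ × ℂ}
    (h : HasStrictFDerivAt H L u) (hB : L (0, 1) ≠ 0) :
    ∀ᶠ p : (ℂ × ℂ) × (ℂ × ℂ) in 𝓝 (u, u), p.1.1 = p.2.1 → H p.1 = H p.2 → p.1 = p.2 := by
  have h1 := h.isLittleO.def (half_pos (norm_pos_iff.2 hB))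
  filter_upwards [h1] with p hp e1 e2
  have e3 : p.1 - p.2 = (p.1.2 - p.2.2) • ((0, 1) : ℂ × ℂ) := by
    ext <;> simp [e1]
  rw [e2, e3, map_smul, sub_self, zero_sub, norm_neg, norm_smul, norm_smul] at hp
  have : ‖((0:ℂ), (1:ℂ))‖ = 1 := by simp [Prod.norm_def]
  rw [this] at hp
  have h0 : 0 < ‖L (0, 1)‖ := norm_pos_iff.2 hB
  have h5 : ‖p.1.2 - p.2.2‖ = 0 := by
    have := norm_nonneg (p.1.2 - p.2.2)
    nlinarith
  rw [norm_eq_zero] at h5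
  rw [h5, zero_smul] at e3
  exact sub_eq_zero.1 e3

lemma rob_deriv {f g : ℂ → ℂ} {g' b K s x : ℂ} (hf : HasStrictDerivAt f (g x) x)
    (hg : HasStrictDerivAt g g' x) :
    ∃ L : ℂ × ℂ →L[ℂ] ℂ, HasStrictFDerivAt
      (fun p : ℂ × ℂ => p.1 * b * f p.2 + (1 - p.1) * p.2 * g p.2 - p.1 * K) L (s, x) ∧
      L (1, 0) = b * f x - x * g x - K ∧ L (0, 1) = s * b * g x + (1 - s) * (g x + x * g') := by
  have h1 : HasStrictFDerivAt (fun p : ℂ × ℂ => p.1) (ContinuousLinearMap.fst ℂ ℂ ℂ) (s, x) :=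
    hasStrictFDerivAt_fst
  have h2 : HasStrictFDerivAt (fun p : ℂ × ℂ => p.2) (ContinuousLinearMap.snd ℂ ℂ ℂ) (s, x) :=
    hasStrictFDerivAt_snd
  have hF := HasStrictDerivAt.comp_hasStrictFDerivAt (h₂ := f) (s, x) hf h2
  have hG := HasStrictDerivAt.comp_hasStrictFDerivAt (h₂ := g) (s, x) hg h2
  refine ⟨_, (((h1.mul_const b).mul hF).add (((h1.const_sub 1).mul h2).mul hG)).sub
    (h1.mul_const K), ?_, ?_⟩
  · simp; ring
  · simp; ring

lemma rob_decr {φ : ℝ → ℝ} {d s : ℝ} (h : HasDerivAt φ d s) (hd : 0 < d) :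
    ∀ᶠ t in 𝓝[<] s, φ t < φ s := by
  have h1 := (hasDerivAt_iff_tendsto_slope.1 h).mono_left (nhdsWithin_mono s
    (fun t (ht : t < s) => ht.ne))
  filter_upwards [h1.eventually (lt_mem_nhds hd), self_mem_nhdsWithin] with t ht hts
  rw [slope_def_field] at ht
  have : t - s < 0 := sub_neg.2 hts
  by_contra hc
  have := div_nonpos_of_nonneg_of_nonpos (sub_nonneg.2 (not_lt.1 hc)) this.le
  linarith

lemma rob_re {W : ℂ} (h : ‖W - 1‖ < 1) : 1 < 2 * (1 / W).re := by
  have h1 : ‖W - 1‖ ^ 2 < 1 := by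
    have := norm_nonneg (W - 1); nlinarith
  rw [← Complex.normSq_eq_norm_sq, Complex.normSq_apply] at h1
  simp at h1
  have h0 : 0 < Complex.normSq W := by
    rw [Complex.normSq_apply]; nlinarith
  rw [one_div, Complex.inv_re, ← mul_div_assoc, lt_div_iff₀ h0, Complex.normSq_apply]
  nlinarith

/-- one-sided motion of a point. -/
lemma rob_move {f g : ℂ → ℂ} {g' c x : ℂ} {s R : ℝ} (hR : 0 < R) (hs : 0 < s)
    (hf : HasStrictDerivAt f (g x) x) (hg : HasStrictDerivAt g g' x)
    (hx : ‖x‖ ^ 2 ≤ R * s) (hc : ‖s * c * g x + (1 - s) * (x * g')‖ < ‖g x‖) :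
    ∃ ψ : ℝ → ℂ, ψ s = x ∧ ContinuousAt ψ s ∧ ∀ᶠ t : ℝ in 𝓝[<] s,
      ‖ψ t‖ ^ 2 ≤ R * t ∧
      t * (1 + c) * f (ψ t) + (1 - t) * ψ t * g (ψ t) =
        t * ((s * (1 + c) * f x + (1 - s) * x * g x) / s) := by
  have hsC : (s : ℂ) ≠ 0 := by exact_mod_cast hs.ne'
  set K : ℂ := (s * (1 + c) * f x + (1 - s) * x * g x) / s with hK
  obtain ⟨L, hL, hL1, hL2⟩ := rob_deriv (b := 1 + c) (K := K) (s := (s : ℂ)) hf hg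
  have hgx : g x ≠ 0 := norm_pos_iff.1 ((norm_nonneg _).trans_lt hc)
  set W : ℂ := L (0, 1) / g x with hW
  have hW1 : W - 1 = (s * c * g x + (1 - s) * (x * g')) / g x := by
    rw [hW, hL2]; field_simp; ring
  have hWn : ‖W - 1‖ < 1 := by
    rw [hW1, norm_div, div_lt_one (norm_pos_iff.2 hgx)]; exact hc
  have hre := rob_re hWn
  have hB : L (0, 1) ≠ 0 := by
    intro h0
    rw [hW, h0] at hre
    simp at hre
    linarith
  obtain ⟨ψ, h1, h2, h3⟩ := rob_implicit hL hB
  have hψ' : - L (1, 0) / L (0, 1) = x * (1 / W) / s := by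
    rw [hW, hL1, hK]
    field_simp
    ring
  rw [hψ'] at h2
  have hcast : Tendsto (fun t : ℝ => (t : ℂ)) (𝓝 s) (𝓝 (s : ℂ)) :=
    Complex.continuous_ofReal.continuousAt
  have h4 : HasDerivAt (fun t : ℝ => ψ t) (x * (1 / W) / s) s := h2.comp_ofReal
  refine ⟨fun t => ψ t, h1, h4.continuousAt, ?_⟩
  have key : ∀ᶠ t : ℝ in 𝓝[<] s, ‖ψ t‖ ^ 2 ≤ R * t := by
    rcases hx.lt_or_eq with hlt | heq
    · have hcont : ContinuousAt (fun t : ℝ => R * t - ‖ψ t‖ ^ 2) s :=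
        (continuousAt_const.mul continuousAt_id).sub (h4.continuousAt.norm.pow 2)
      have : 0 < R * s - ‖ψ s‖ ^ 2 := by rw [h1]; linarith
      filter_upwards [nhdsWithin_le_nhds (hcont.eventually (lt_mem_nhds this))] with t ht
      linarith
    · have h5 := h4.norm_sq.sub ((hasDerivAt_id s).const_mul R)
      have h6 : 0 < 2 * inner ℝ (ψ s) (x * (1 / W) / s) - R * 1 := by
        have : inner ℝ (ψ s) (x * (1 / W) / s) = ‖x‖ ^ 2 * (1 / W).re / s := by
          rw [h1, Complex.inner]
          have : x * (1 / W) / s * (starRingEnd ℂ) x = ((‖x‖ ^ 2 / s : ℝ) : ℂ) * (1 / W) := by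
            rw [← Complex.normSq_eq_norm_sq]
            push_cast
            rw [← Complex.mul_conj]
            ring
          rw [this, Complex.re_ofReal_mul]; ring
        rw [this, heq]
        field_simp
        have := hre
        simp only [one_div] at this ⊢
        nlinarith
      filter_upwards [rob_decr h5 h6] with t ht
      simp [h1, heq] at ht
      exact ht.le
  filter_upwards [key, nhdsWithin_le_nhds (hcast.eventually h3)] with t ht1 ht2
  refine ⟨ht1, ?_⟩
  have : (s : ℂ) * (1 + c) * f x + (1 - s) * x * g x - s * K = 0 := by
    rw [hK]; field_simp; ring
  rw [this] at ht2
  linear_combination ht2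

lemma rob_chain {f : ℂ → ℂ} (hf : DifferentiableOn ℂ f (ball (0 : ℂ) 1)) {R : ℝ} (hR : 0 < R)
    (hR1 : R < 1) (c : ℂ)
    (hc : ∀ s : ℝ, 0 ≤ s → s ≤ 1 → ∀ x : ℂ, ‖x‖ ^ 2 ≤ R * s →
      ‖s * c * deriv f x + (1 - s) * (x * deriv (deriv f) x)‖ < ‖deriv f x‖)
    {z w : ℂ} (hz : ‖z‖ ^ 2 ≤ R) (hw : ‖w‖ ^ 2 ≤ R) (hzw : f z = f w) : z = w := by
  by_contra hne
  have hball : ∀ s : ℝ, s ≤ 1 → ∀ x : ℂ, ‖x‖ ^ 2 ≤ R * s → x ∈ ball (0 : ℂ) 1 := by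
    intro s hs x hx
    rw [mem_ball_zero_iff]
    have := norm_nonneg x
    nlinarith
  have han : ∀ x ∈ ball (0 : ℂ) 1, AnalyticAt ℂ f x := fun x hx =>
    hf.analyticAt (isOpen_ball.mem_nhds hx)
  have hsf : ∀ x ∈ ball (0 : ℂ) 1, HasStrictDerivAt f (deriv f x) x := fun x hx =>
    (han x hx).hasStrictDerivAt
  have hsg : ∀ x ∈ ball (0 : ℂ) 1, HasStrictDerivAt (deriv f) (deriv (deriv f) x) x := fun x hx =>
    (han x hx).deriv.hasStrictDerivAt
  set G : ℝ → ℂ → ℂ := fun s x => s * (1 + c) * f x + (1 - s) * x * deriv f x with hG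
  set C : Set (ℝ × ℂ × ℂ) := {p | p.1 ∈ Set.Icc (0:ℝ) 1 ∧ ‖p.2.1‖ ^ 2 ≤ R * p.1 ∧
    ‖p.2.2‖ ^ 2 ≤ R * p.1} with hC
  set K : Set (ℝ × ℂ × ℂ) := {p | p ∈ C ∧ G p.1 p.2.1 = G p.1 p.2.2 ∧ p.2.1 ≠ p.2.2} with hK
  have hCcl : IsClosed C := by
    have c1 : IsClosed {p : ℝ × ℂ × ℂ | p.1 ∈ Set.Icc (0:ℝ) 1} :=
      isClosed_Icc.preimage continuous_fst
    have c2 : IsClosed {p : ℝ × ℂ × ℂ | ‖p.2.1‖ ^ 2 ≤ R * p.1} :=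
      isClosed_le (by fun_prop) (by fun_prop)
    have c3 : IsClosed {p : ℝ × ℂ × ℂ | ‖p.2.2‖ ^ 2 ≤ R * p.1} :=
      isClosed_le (by fun_prop) (by fun_prop)
    have : C = {p : ℝ × ℂ × ℂ | p.1 ∈ Set.Icc (0:ℝ) 1} ∩ ({p : ℝ × ℂ × ℂ | ‖p.2.1‖ ^ 2 ≤ R * p.1} ∩
        {p : ℝ × ℂ × ℂ | ‖p.2.2‖ ^ 2 ≤ R * p.1}) := by
      ext p; rfl
    rw [this]
    exact c1.inter (c2.inter c3)
  have hCb : C ⊆ Set.Icc (0:ℝ) 1 ×ˢ (closedBall (0:ℂ) 1 ×ˢ closedBall (0:ℂ) 1) := by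
    rintro ⟨s, x, y⟩ ⟨h1, h2, h3⟩
    exact ⟨h1, ball_subset_closedBall (hball s h1.2 x h2),
      ball_subset_closedBall (hball s h1.2 y h3)⟩
  have hCc : IsCompact C := (isCompact_Icc.prod
    ((isCompact_closedBall _ _).prod (isCompact_closedBall _ _))).of_isClosed_subset hCcl hCb
  have hKcl : IsClosed K := by
    refine isClosed_of_closure_subset ?_
    rintro ⟨s, x, y⟩ hp
    have hpC : (s, x, y) ∈ C := closure_minimal (fun q hq => hq.1) hCcl hp
    have hfr := mem_closure_iff_frequently.1 hp
    obtain ⟨hs, hx, hy⟩ := id hpC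
    simp only at hs hx hy
    have hxb := hball s hs.2 x hx
    have hyb := hball s hs.2 y hy
    refine ⟨hpC, ?_, ?_⟩
    · by_contra hneq
      have hcG : ContinuousAt (fun p : ℝ × ℂ × ℂ => G p.1 p.2.1 - G p.1 p.2.2) (s, x, y) := by
        have a1 : ContinuousAt (fun p : ℝ × ℂ × ℂ => (p.1 : ℂ)) (s, x, y) := by fun_prop
        have a2 : ContinuousAt (fun p : ℝ × ℂ × ℂ => p.2.1) (s, x, y) := by fun_prop
        have a3 : ContinuousAt (fun p : ℝ × ℂ × ℂ => p.2.2) (s, x, y) := by fun_prop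
        have b1 : ContinuousAt (fun p : ℝ × ℂ × ℂ => f p.2.1) (s, x, y) :=
          ContinuousAt.comp (g := f) (han x hxb).continuousAt a2
        have b2 : ContinuousAt (fun p : ℝ × ℂ × ℂ => f p.2.2) (s, x, y) :=
          ContinuousAt.comp (g := f) (han y hyb).continuousAt a3
        have b3 : ContinuousAt (fun p : ℝ × ℂ × ℂ => deriv f p.2.1) (s, x, y) :=
          ContinuousAt.comp (g := deriv f) (han x hxb).deriv.continuousAt a2
        have b4 : ContinuousAt (fun p : ℝ × ℂ × ℂ => deriv f p.2.2) (s, x, y) :=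
          ContinuousAt.comp (g := deriv f) (han y hyb).deriv.continuousAt a3
        simp only [hG]
        fun_prop
      have := hcG.eventually_ne (sub_ne_zero.2 hneq)
      obtain ⟨q, hq, hq'⟩ := (hfr.and_eventually this).exists
      exact hq' (sub_eq_zero.2 hq.2.1)
    · intro hxy
      simp only at hxy
      subst hxy
      obtain ⟨L, hL, -, hL2⟩ := rob_deriv (b := 1 + c) (K := 0) (s := (s : ℂ))
        (hsf x hxb) (hsg x hxb)
      have hB : L (0, 1) ≠ 0 := by
        intro h0
        have h1 := hc s hs.1 hs.2 x hx
        have : s * c * deriv f x + (1 - s) * (x * deriv (deriv f) x) = - deriv f x := by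
          rw [h0] at hL2
          linear_combination -hL2
        rw [this, norm_neg] at h1
        exact lt_irrefl _ h1
      have hli := rob_localinj hL hB
      have ht : Tendsto (fun p : ℝ × ℂ × ℂ => (((p.1 : ℂ), p.2.1), ((p.1 : ℂ), p.2.2)))
          (𝓝 (s, x, x)) (𝓝 (((s : ℂ), x), ((s : ℂ), x))) :=
        Continuous.tendsto (f := fun p : ℝ × ℂ × ℂ => (((p.1 : ℂ), p.2.1), ((p.1 : ℂ), p.2.2)))
          (by fun_prop) (s, x, x)
      obtain ⟨q, hq, hq'⟩ := (hfr.and_eventually (ht.eventually hli)).exists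
      have e := hq' rfl (by simpa [hG] using hq.2.1)
      exact hq.2.2 (Prod.ext_iff.1 e).2
  have hKc : IsCompact K := hCc.of_isClosed_subset hKcl (fun q hq => hq.1)
  have hKne : K.Nonempty := by
    refine ⟨(1, z, w), ⟨⟨by simp, by simpa using hz, by simpa using hw⟩, ?_, hne⟩⟩
    simp [hG, hzw]
  obtain ⟨⟨s, x, y⟩, hmem, hmin⟩ := hKc.exists_isMinOn hKne continuous_fst.continuousOn
  obtain ⟨⟨hs, hx, hy⟩, hGe, hxy⟩ := hmem
  simp only at hs hx hy hGe hxy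
  have hs0 : 0 < s := by
    rcases hs.1.lt_or_eq with h | h
    · exact h
    · exfalso
      rw [← h] at hx hy
      have hx0 : x = 0 := by simpa using hx
      have hy0 : y = 0 := by simpa using hy
      exact hxy (hx0.trans hy0.symm)
  have hxb := hball s hs.2 x hx
  have hyb := hball s hs.2 y hy
  obtain ⟨ψ, p1, p2, p3⟩ := rob_move hR hs0 (hsf x hxb) (hsg x hxb) hx (hc s hs.1 hs.2 x hx)
  obtain ⟨χ, q1, q2, q3⟩ := rob_move hR hs0 (hsf y hyb) (hsg y hyb) hy (hc s hs.1 hs.2 y hy)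
  have hne' : ∀ᶠ t in 𝓝[<] s, ψ t - χ t ≠ 0 :=
    nhdsWithin_le_nhds ((p2.sub q2).eventually_ne (by
      simp only [Pi.sub_apply, p1, q1]; exact sub_ne_zero.2 hxy))
  have hpos : ∀ᶠ t in 𝓝[<] s, 0 < t := nhdsWithin_le_nhds (lt_mem_nhds hs0)
  obtain ⟨t, ht⟩ := (p3.and (q3.and (hne'.and (hpos.and self_mem_nhdsWithin)))).exists
  obtain ⟨⟨t1, t2⟩, ⟨t3, t4⟩, t5, t6, t7⟩ := ht
  have t7 : t < s := t7
  have hin : (t, ψ t, χ t) ∈ K := by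
    refine ⟨⟨⟨t6.le, (t7.le.trans hs.2)⟩, t1, t3⟩, ?_, sub_ne_zero.1 t5⟩
    simp only [hG] at hGe ⊢
    rw [t2, t4, hGe]
  have := hmin hin
  have : s ≤ t := this
  linarith

lemma rob_alg {R s : ℝ} (hR : 0 < R) (hR1 : R < 1) (hs : 0 ≤ s) (hs1 : s ≤ 1) {u : ℂ}
    (hu : ‖u‖ ≤ R * s) :
    ‖(2 * u / (1 - u)) * (1 - s) - (1 - ((1 - R) ^ 2 / 32 : ℝ)) * s‖ < 1 := by
  set δ : ℝ := (1 - R) ^ 2 / 32 with hδ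
  have hδ0 : 0 < δ := by have : 0 < 1 - R := by linarith
                         positivity
  have hδ1 : δ < 1 := by rw [hδ]; nlinarith
  have hu1 : ‖u‖ ≤ R := by nlinarith
  have hun := norm_nonneg u
  have h1u : 1 - R ≤ ‖1 - u‖ := by
    have := norm_sub_norm_le (1:ℂ) u
    simp at this; linarith
  have h1u' : ‖1 - u‖ ≤ 2 := by
    have := norm_sub_le (1:ℂ) u
    simp at this; linarith
  have hpos : 0 < ‖1 - u‖ := by linarith
  have hne : 1 - u ≠ 0 := norm_pos_iff.1 hpos
  set q : ℂ := 2 * u / (1 - u) with hq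
  have hqn : ‖q‖ ≤ 2 / (1 - R) := by
    rw [hq, norm_div, norm_mul]
    simp only [Complex.norm_ofNat]
    gcongr
    linarith
  set N : ℝ := ‖q * (1 - s) - s‖ with hN
  have hN0 : 0 ≤ N := norm_nonneg _
  -- main estimate
  have hmain : N ^ 2 * ‖1 - u‖ ^ 2 ≤ ‖1 - u‖ ^ 2 - (1 - s) * (1 - R) := by
    have e : (q * (1 - s) - s) * (1 - u) = (2 - s : ℝ) * u - s := by
      rw [hq]; push_cast; field_simp; ring
    rw [hN, ← mul_pow, ← norm_mul, e]
    have hre : u.re ≤ ‖u‖ := Complex.re_le_norm u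
    have a1 : ‖((2 - s : ℝ) : ℂ) * u - s‖ ^ 2 = (2 - s) ^ 2 * ‖u‖ ^ 2 - 2 * (2 - s) * s * u.re + s ^ 2 := by
      simp only [← Complex.normSq_eq_norm_sq, Complex.normSq_apply]
      simp; ring
    have a2 : ‖1 - u‖ ^ 2 = 1 - 2 * u.re + ‖u‖ ^ 2 := by
      simp only [← Complex.normSq_eq_norm_sq, Complex.normSq_apply]
      simp; ring
    rw [a1, a2]
    have hb : 1 - R ≤ 1 + s - (3 - s) * ‖u‖ ^ 2 - 2 * (1 - s) * u.re := by
      have b1 : ‖u‖ ^ 2 ≤ R * s ^ 2 := by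
        have : ‖u‖ ^ 2 ≤ (R * s) ^ 2 := by gcongr
        nlinarith [sq_nonneg s]
      have b2 : (3 - s) * ‖u‖ ^ 2 ≤ (3 - s) * (R * s ^ 2) := by
        apply mul_le_mul_of_nonneg_left b1; linarith
      have b3 : (1 - s) * u.re ≤ (1 - s) * (R * s) := by
        apply mul_le_mul_of_nonneg_left _ (by linarith); linarith
      have b4 : 0 ≤ R * ((1 - s) ^ 2 * (1 + s)) := by positivity
      have b5 : 0 ≤ s * (1 - R) := mul_nonneg hs (by linarith)
      nlinarith
    have := mul_le_mul_of_nonneg_left hb (show 0 ≤ 1 - s by linarith)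
    nlinarith
  have hN1 : N ≤ 1 := by
    have : 0 ≤ (1 - s) * (1 - R) := mul_nonneg (by linarith) (by linarith)
    have h2 : N ^ 2 * ‖1 - u‖ ^ 2 ≤ 1 * ‖1 - u‖ ^ 2 := by linarith
    have h3 := le_of_mul_le_mul_right h2 (by positivity)
    nlinarith
  by_cases hcase : (1 - s) * ‖q‖ < 1
  · have e : q * (1 - s) - (1 - (δ : ℝ)) * s
        = ((1 - δ : ℝ) : ℂ) * (q * (1 - s) - s) + (δ : ℂ) * (((1 - s : ℝ) : ℂ) * q) := by
      push_cast; ring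
    rw [e]
    refine (norm_add_le _ _).trans_lt ?_
    rw [norm_mul, norm_mul, norm_mul, Complex.norm_real, Complex.norm_real, Complex.norm_real,
      Real.norm_of_nonneg (show 0 ≤ 1 - δ by linarith), Real.norm_of_nonneg hδ0.le,
      Real.norm_of_nonneg (show 0 ≤ 1 - s by linarith)]
    nlinarith
  · have hR2 : 0 < 1 - R := by linarith
    have h1 : 1 ≤ (1 - s) * (2 / (1 - R)) :=
      (not_lt.1 hcase).trans (mul_le_mul_of_nonneg_left hqn (by linarith))
    rw [← mul_div_assoc, le_div_iff₀ hR2] at h1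
    have h2 : N ^ 2 ≤ 1 - (1 - R) ^ 2 / 8 := by
      have h4 : ‖1 - u‖ ^ 2 ≤ 4 := by nlinarith
      have h5 : (1 - R) ^ 2 / 2 ≤ (1 - s) * (1 - R) := by nlinarith
      by_contra hcon
      push Not at hcon
      nlinarith [mul_pos (show 0 < N ^ 2 - (1 - (1 - R) ^ 2 / 8) by linarith) (show 0 < ‖1 - u‖ ^ 2 by positivity),
        mul_nonneg (show 0 ≤ 4 - ‖1 - u‖ ^ 2 by linarith) (sq_nonneg (1 - R))]
    have h3 : N ≤ 1 - (1 - R) ^ 2 / 16 := by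
      nlinarith [sq_nonneg (1 - N)]
    have e : q * (1 - s) - (1 - (δ : ℝ)) * s = (q * (1 - s) - s) + ((δ * s : ℝ) : ℂ) := by
      push_cast; ring
    rw [e]
    refine (norm_add_le _ _).trans_lt ?_
    rw [Complex.norm_real, Real.norm_of_nonneg (by positivity)]
    have : 0 < (1 - R) ^ 2 := by positivity
    nlinarith

/-- A λ-Robertson function with `f''(0) = 0` is univalent on 𝔻. -/
theorem robertson_univalent_second_deriv_zero (lam : ℝ)
    (hlam : lam ∈ Set.Ioo (-(Real.pi / 2)) (Real.pi / 2))
    (f : ℂ → ℂ)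
    (hf : DifferentiableOn ℂ f (ball (0 : ℂ) 1))
    (hf0 : f 0 = 0) (hf'0 : deriv f 0 = 1)
    (hf''0 : deriv (deriv f) 0 = 0)
    (hf' : ∀ z ∈ ball (0 : ℂ) 1, deriv f z ≠ 0)
    (hRob : ∀ z ∈ ball (0 : ℂ) 1,
      0 < (Complex.exp (-(lam : ℂ) * Complex.I) *
        (1 + z * deriv (deriv f) z / deriv f z)).re) :
    Set.InjOn f (ball (0 : ℂ) 1) := by
  have hcos : 0 < Real.cos lam := Real.cos_pos_of_mem_Ioo hlam
  have hcosC : (Real.cos lam : ℂ) ≠ 0 := by exact_mod_cast hcos.ne'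
  set E : ℂ := Complex.exp (-(lam : ℂ) * Complex.I) with hE
  have hE0 : E ≠ 0 := Complex.exp_ne_zero _
  have hEn : ‖E‖ = 1 := by
    have : E = Complex.exp ((-lam : ℝ) * Complex.I) := by rw [hE]; push_cast; rfl
    rw [this, Complex.norm_exp_ofReal_mul_I]
  have hEre : E.re = Real.cos lam := by
    have : E = Complex.exp ((-lam : ℝ) * Complex.I) := by rw [hE]; push_cast; rfl
    rw [this, Complex.exp_ofReal_mul_I_re, Real.cos_neg]
  have hg : DifferentiableOn ℂ (deriv f) (ball (0 : ℂ) 1) := hf.deriv isOpen_ball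
  have hg' : DifferentiableOn ℂ (deriv (deriv f)) (ball (0 : ℂ) 1) := hg.deriv isOpen_ball
  set Q : ℂ → ℂ := fun z => z * deriv (deriv f) z / deriv f z with hQ
  -- `m = p - 1`
  set m : ℂ → ℂ := fun z => E * Q z / Real.cos lam with hm
  have hmd : DifferentiableOn ℂ m (ball (0 : ℂ) 1) :=
    (((differentiableOn_id.mul hg').div hg hf').const_mul E).div_const _
  have hmre : ∀ z ∈ ball (0 : ℂ) 1, -1 < (m z).re := by
    intro z hz
    have h := hRob z hz
    have h2 : E * (1 + z * deriv (deriv f) z / deriv f z) = E + Real.cos lam * m z := by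
      simp only [hm, hQ]
      field_simp
    rw [h2, Complex.add_re, hEre, Complex.re_ofReal_mul] at h
    nlinarith
  set U : ℂ → ℂ := fun z => m z / (m z + 2) with hU
  have hm2 : ∀ z ∈ ball (0 : ℂ) 1, m z + 2 ≠ 0 := by
    intro z hz h0
    have := congrArg Complex.re h0
    simp at this
    linarith [hmre z hz]
  have hUd : DifferentiableOn ℂ U (ball (0 : ℂ) 1) := hmd.div (hmd.add_const 2) hm2
  have hm0 : m 0 = 0 := by simp [hm, hQ]
  have hU0 : U 0 = 0 := by simp [hU, hm0]
  have hUmaps : Set.MapsTo U (ball (0 : ℂ) 1) (closedBall (U 0) 1) := by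
    intro z hz
    rw [hU0, mem_closedBall_zero_iff, hU, norm_div, div_le_one (norm_pos_iff.2 (hm2 z hz))]
    have h := hmre z hz
    rw [← sq_le_sq₀ (norm_nonneg _) (norm_nonneg _), ← Complex.normSq_eq_norm_sq,
      ← Complex.normSq_eq_norm_sq, Complex.normSq_apply, Complex.normSq_apply]
    simp
    nlinarith
  have h0b : (0 : ℂ) ∈ ball (0 : ℂ) 1 := by simp
  have hUo : (fun z => U z - U 0) =o[𝓝 (0:ℂ)] (fun w : ℂ => ‖w - 0‖ ^ 1) := by
    have hQd : HasDerivAt Q 0 0 := by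
      have h1 : HasDerivAt (deriv (deriv f)) (deriv (deriv (deriv f)) 0) 0 :=
        (hg'.differentiableAt (isOpen_ball.mem_nhds h0b)).hasDerivAt
      have h2 : HasDerivAt (deriv f) (deriv (deriv f) 0) 0 :=
        (hg.differentiableAt (isOpen_ball.mem_nhds h0b)).hasDerivAt
      have := ((hasDerivAt_id (0:ℂ)).mul h1).div h2 (hf' 0 h0b)
      refine HasDerivAt.congr_deriv this ?_
      simp [hf''0]
    have hmdd : HasDerivAt m 0 0 := by
      have := (hQd.const_mul E).div_const (Real.cos lam : ℂ)
      refine HasDerivAt.congr_deriv this ?_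
      simp
    have hUdd : HasDerivAt U 0 0 := by
      have := hmdd.div (hmdd.add_const 2) (hm2 0 h0b)
      refine HasDerivAt.congr_deriv this ?_
      simp
    have := hUdd.isLittleO
    simpa using this.norm_right
  have hUb : ∀ z ∈ ball (0 : ℂ) 1, ‖U z‖ ≤ ‖z‖ ^ 2 := by
    intro z hz
    have := Complex.dist_le_mul_div_pow_of_mapsTo_ball_of_isLittleO (n := 1) hUd hUmaps hUo hz
    simpa [hU0] using this
  have hmU : ∀ z ∈ ball (0 : ℂ) 1, m z = 2 * U z / (1 - U z) := by
    intro z hz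
    have h2 := hm2 z hz
    have : 1 - U z = 2 / (m z + 2) := by
      simp only [hU]; field_simp; ring
    rw [this]; simp only [hU]; field_simp
  have hcE : ‖(Real.cos lam : ℂ) / E‖ ≤ 1 := by
    rw [norm_div, hEn, div_one, Complex.norm_real, Real.norm_of_nonneg hcos.le]
    exact Real.cos_le_one _
  intro z hz w hw hzw
  by_contra hne
  set R : ℝ := max (‖z‖ ^ 2) (‖w‖ ^ 2) with hRdef
  have hRz : ‖z‖ ^ 2 ≤ R := le_max_left _ _
  have hRw : ‖w‖ ^ 2 ≤ R := le_max_right _ _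
  have hR1 : R < 1 := by
    rw [mem_ball_zero_iff] at hz hw
    have := norm_nonneg z
    have := norm_nonneg w
    exact max_lt (by nlinarith) (by nlinarith)
  have hR : 0 < R := by
    by_contra hcon
    have hz0 : ‖z‖ ^ 2 = 0 := le_antisymm (by linarith) (by positivity)
    have hw0 : ‖w‖ ^ 2 = 0 := le_antisymm (by linarith) (by positivity)
    have hz1 : z = 0 := by simpa using hz0
    have hw1 : w = 0 := by simpa using hw0
    exact hne (hz1.trans hw1.symm)
  set k : ℂ := 1 - ((1 - R) ^ 2 / 32 : ℝ) with hk
  refine hne (rob_chain hf hR hR1 (-(k * (Real.cos lam / E))) ?_ hRz hRw hzw)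
  intro s hs hs1 x hx
  have hxb : x ∈ ball (0 : ℂ) 1 := by
    rw [mem_ball_zero_iff]
    have := norm_nonneg x
    nlinarith
  have hfx := hf' x hxb
  have hal := rob_alg hR hR1 hs hs1 ((hUb x hxb).trans hx)
  rw [← hmU x hxb, ← hk] at hal
  have e : s * (-(k * (Real.cos lam / E))) * deriv f x + (1 - s) * (x * deriv (deriv f) x)
      = (Real.cos lam / E) * (m x * (1 - s) - k * s) * deriv f x := by
    simp only [hm, hQ]
    field_simp
    ring
  rw [e, norm_mul, norm_mul]
  have hp : 0 < ‖deriv f x‖ := norm_pos_iff.2 hfx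
  have hlt : ‖(Real.cos lam : ℂ) / E‖ * ‖m x * (1 - s) - k * s‖ < 1 := by
    have := norm_nonneg (m x * (1 - s) - k * s)
    have := norm_nonneg ((Real.cos lam : ℂ) / E)
    nlinarith
  nlinarith
end

section
/- Let λ ∈ (−π/2, π/2) and define f_λ(z) = ((1 − z)^{1 − 2 e^{iλ} cos λ} − 1)/(2 e^{iλ} cos λ − 1) on the unit disk 𝔻, using the principal branch of the power. Then f_λ is a λ-Robertson function; that is, f_λ is analytic on 𝔻 with f_λ(0) = 0, f_λ'(0) = 1, f_λ'(z) ≠ 0 on 𝔻, and Re(e^{−iλ}(1 + z f_λ''(z)/f_λ'(z))) > 0 for all z ∈ 𝔻. -/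
open Metric

lemma slit_aux {z : ℂ} (hz : z ∈ ball (0 : ℂ) 1) : 0 < (1 - z).re := by
  have h1 : ‖z‖ < 1 := by simpa using hz
  have h2 := Complex.re_le_norm z
  simp only [Complex.sub_re, Complex.one_re]
  linarith

lemma pow_aux (c : ℂ) {z : ℂ} (hz : z ∈ ball (0 : ℂ) 1) :
    HasDerivAt (fun w : ℂ => (1 - w) ^ c) (-(c * (1 - z) ^ (c - 1))) z := by
  have h : HasDerivAt (fun w : ℂ => 1 - w) (-1) z := by
    simpa using (hasDerivAt_id z).const_sub 1
  have := h.cpow_const (c := c) (Or.inl (slit_aux hz))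
  convert this using 1
  ring

/-- The function `f_λ(z) = ((1 − z)^{1 − 2e^{iλ}cos λ} − 1)/(2e^{iλ}cos λ − 1)`
(principal branch, λ ≠ 0) is a λ-Robertson function. -/
theorem extremal_is_robertson (lam : ℝ)
    (hlam : lam ∈ Set.Ioo (-(Real.pi / 2)) (Real.pi / 2)) (hlam0 : lam ≠ 0)
    (flam : ℂ → ℂ)
    (hdef : ∀ z : ℂ, flam z =
      ((1 - z) ^ ((1 : ℂ) - 2 * Complex.exp ((lam : ℂ) * Complex.I) * ((Real.cos lam : ℝ) : ℂ)) - 1) /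
        (2 * Complex.exp ((lam : ℂ) * Complex.I) * ((Real.cos lam : ℝ) : ℂ) - 1)) :
    DifferentiableOn ℂ flam (ball (0 : ℂ) 1) ∧
    flam 0 = 0 ∧
    deriv flam 0 = 1 ∧
    (∀ z ∈ ball (0 : ℂ) 1, deriv flam z ≠ 0) ∧
    (∀ z ∈ ball (0 : ℂ) 1,
      0 < (Complex.exp (-(lam : ℂ) * Complex.I) *
        (1 + z * deriv (deriv flam) z / deriv flam z)).re) := by
  set a : ℂ := 2 * Complex.exp ((lam : ℂ) * Complex.I) * ((Real.cos lam : ℝ) : ℂ) with ha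
  have hee : Complex.exp (-(lam : ℂ) * Complex.I) * Complex.exp ((lam : ℂ) * Complex.I) = 1 := by
    rw [← Complex.exp_add]; simp
  have ha1 : a - 1 ≠ 0 := by
    have : a - 1 = Complex.exp ((lam : ℂ) * Complex.I) * Complex.exp ((lam : ℂ) * Complex.I) := by
      rw [ha, Complex.ofReal_cos, Complex.cos]
      linear_combination hee
    rw [this]
    exact mul_ne_zero (Complex.exp_ne_zero _) (Complex.exp_ne_zero _)
  have hf : flam = fun z => ((1 - z) ^ (1 - a) - 1) / (a - 1) := funext hdef
  have hd : ∀ z ∈ ball (0 : ℂ) 1, HasDerivAt flam ((1 - z) ^ (-a)) z := by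
    intro z hz
    rw [hf]
    have := ((pow_aux (1 - a) hz).sub_const 1).div_const (a - 1)
    have e : -((1 - a) * (1 - z) ^ (1 - a - 1)) / (a - 1) = (1 - z) ^ (-a) := by
      rw [show 1 - a - 1 = -a by ring, div_eq_iff ha1]
      ring
    rw [e] at this
    exact this
  have hne : ∀ z ∈ ball (0 : ℂ) 1, (1 - z) ≠ 0 := by
    intro z hz h
    have := slit_aux hz
    rw [h] at this
    simp at this
  have hdne : ∀ z ∈ ball (0 : ℂ) 1, (1 - z) ^ (-a) ≠ 0 := by
    intro z hz h
    exact hne z hz ((Complex.cpow_eq_zero_iff _ _).1 h).1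
  have h0 : (0 : ℂ) ∈ ball (0 : ℂ) 1 := by simp
  refine ⟨fun z hz => (hd z hz).differentiableAt.differentiableWithinAt, ?_, ?_, ?_, ?_⟩
  · rw [hf]; simp
  · rw [(hd 0 h0).deriv]; simp
  · intro z hz
    rw [(hd z hz).deriv]; exact hdne z hz
  · intro z hz
    have hev : deriv flam =ᶠ[nhds z] fun w => (1 - w) ^ (-a) := by
      filter_upwards [isOpen_ball.mem_nhds hz] with w hw
      exact (hd w hw).deriv
    rw [hev.deriv_eq, (pow_aux (-a) hz).deriv, (hd z hz).deriv,
      Complex.cpow_sub _ _ (hne z hz), Complex.cpow_one]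
    have hn := hne z hz
    have hp := hdne z hz
    have e1 : z * -(-a * ((1 - z) ^ (-a) / (1 - z))) / (1 - z) ^ (-a) = a * (z / (1 - z)) := by
      field_simp
    rw [e1]
    have e2 : Complex.exp (-(lam : ℂ) * Complex.I) * (1 + a * (z / (1 - z))) =
        Complex.exp (-(lam : ℂ) * Complex.I) +
          ((2 * Real.cos lam : ℝ) : ℂ) * (z / (1 - z)) := by
      rw [ha]; push_cast
      linear_combination (2 * Complex.cos lam * (z / (1 - z))) * hee
    have e3 : (Complex.exp (-(lam : ℂ) * Complex.I)).re = Real.cos lam := by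
      have := Complex.exp_ofReal_mul_I_re (-lam)
      simpa using this
    rw [e2, Complex.add_re, Complex.re_ofReal_mul, e3]
    have hc : 0 < Real.cos lam := Real.cos_pos_of_mem_Ioo ⟨by linarith [hlam.1], hlam.2⟩
    have hN : 0 < Complex.normSq (1 - z) := Complex.normSq_pos.2 hn
    have hz1 : Complex.normSq z < 1 := by
      have h1 : ‖z‖ < 1 := by simpa using hz
      rw [Complex.normSq_eq_norm_sq]
      nlinarith [norm_nonneg z]
    have e4 : 1 + 2 * (z / (1 - z)).re = (1 - Complex.normSq z) / Complex.normSq (1 - z) := by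
      rw [Complex.div_re]
      field_simp
      simp only [Complex.normSq_apply, Complex.sub_re, Complex.sub_im, Complex.one_re,
        Complex.one_im]
      ring
    have : 0 < 1 + 2 * (z / (1 - z)).re := by
      rw [e4]; exact div_pos (by linarith) hN
    nlinarith [mul_pos hc this]
end
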